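/- (Two-level Gevrey and q-Gevrey Ramis–Sibuya theorem.) Let (E, ||·||_E) be a complex Banach space, q > 1, k ≥ 1 an integer, kappa > 0, and let {E_{p',p}} (0 ≤ p ≤ ς−1, 0 ≤ p' ≤ χ_p−1) be a good covering in ℂ*. For each (p',p) let G_{p',p} : E_{p',p} → E be holomorphic, and set Δ_{(p1,p),(p2,p')}(eps) = G_{p2,p'}(eps) − G_{p1,p}(eps) for eps ∈ E_{p1,p} ∩ E_{p2,p'} whenever this intersection is nonempty. Assume: (1) each G_{p',p}(eps) is bounded as eps ∈ E_{p',p} tends to 0; (2) for every p and p1 ≠ p2 with E_{p1,p} ∩ E_{p2,p} ≠ ∅ there exist K1, M1 > 0 with ||Δ_{(p1,p),(p2,p)}(eps)||_E ≤ K1 exp(−M1/|eps|^k) on E_{p1,p} ∩ E_{p2,p}; (3) for every p ≠ p' and all p1, p2 with E_{p1,p} ∩ E_{p2,p'} ≠ ∅ there exist K2 > 0 and M2 ∈ ℝ with ||Δ_{(p1,p),(p2,p')}(eps)||_E ≤ K2 |eps|^{M2} exp( −(kappa/(2 log q)) log^2 |eps| ) on E_{p1,p} ∩ E_{p2,p'}.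 Then there exist a convergent power series a(eps) ∈ E{eps}, defined on a neighborhood of the origin, and formal power series Ĝ_1(eps), Ĝ_2(eps) ∈ E[[eps]] such that for every 0 ≤ p ≤ ς−1 and 0 ≤ p1 ≤ χ_p−1 one can write G_{p1,p}(eps) = a(eps) + G^1_{p1,p}(eps) + G^2_{p1,p}(eps), where G^1_{p1,p} is holomorphic on E_{p1,p} and admits Ĝ_1 as its Gevrey asymptotic expansion of order 1/k on E_{p1,p}, and G^2_{p1,p} is holomorphic on E_{p1,p} and admits Ĝ_2 as its q-Gevrey asymptotic expansion of order 1/kappa on E_{p1,p}; both formal series are common to all (p1,p). -/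

import Mathlib

/- Statement 18: two-level (Gevrey and q-Gevrey) Ramis-Sibuya theorem. -/

/-- An open bounded sector centered at the origin, of radius `r`,
with arguments ranging in `(θ1, θ2)`. -/
def planarSector (θ1 θ2 r : ℝ) : Set ℂ :=
  {z : ℂ | ∃ ρ θ : ℝ, 0 < ρ ∧ ρ < r ∧ θ1 < θ ∧ θ < θ2 ∧
    z = (ρ : ℂ) * Complex.exp ((θ : ℂ) * Complex.I)}

/-- q-Gevrey asymptotic expansion of order `1/kk` on `V`. -/
def qAsymp {F : Type*} [NormedAddCommGroup F] [NormedSpace ℂ F]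
    (q kk : ℝ) (V : Set ℂ) (f : ℂ → F) (fn : ℕ → F) : Prop :=
  ∀ θ1 θ2 r : ℝ, planarSector θ1 θ2 r ⊆ V →
    closure (planarSector θ1 θ2 r) ⊆ V ∪ {0} →
    ∃ A C : ℝ, 0 < A ∧ 0 < C ∧
      ∀ N : ℕ, ∀ eps ∈ planarSector θ1 θ2 r,
        ‖f eps - ∑ n ∈ Finset.range (N + 1), eps ^ n • fn n‖
          ≤ C * A ^ (N + 1) * q ^ (((N : ℝ) + 1) * N / (2 * kk)) * ‖eps‖ ^ (N + 1)

/-- Gevrey asymptotic expansion of order `1/kk` on `V`. -/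
def gevreyAsymp {F : Type*} [NormedAddCommGroup F] [NormedSpace ℂ F]
    (kk : ℝ) (V : Set ℂ) (f : ℂ → F) (fn : ℕ → F) : Prop :=
  ∀ θ1 θ2 r : ℝ, planarSector θ1 θ2 r ⊆ V →
    closure (planarSector θ1 θ2 r) ⊆ V ∪ {0} →
    ∃ C M : ℝ, 0 < C ∧ 0 < M ∧
      ∀ N : ℕ, 1 ≤ N → ∀ eps ∈ planarSector θ1 θ2 r,
        ‖f eps - ∑ n ∈ Finset.range N, eps ^ n • fn n‖
          ≤ C * M ^ N * ((N.factorial : ℝ)) ^ (1 / kk) * ‖eps‖ ^ N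

/-- The successor of the double index `(p, p')` in the cyclic lexicographic ordering of
the doubly indexed family of sectors. -/
def nextIdx (ς : ℕ) (χ : ℕ → ℕ) (p p' : ℕ) : ℕ × ℕ :=
  if p' + 1 < χ p then (p, p' + 1) else ((p + 1) % ς, 0)

/-- A doubly indexed good covering in `ℂ*` by open sectors of radius `eps0`. -/
def IsGoodCovering2 (ς : ℕ) (χ : ℕ → ℕ) (eps0 : ℝ) (E : ℕ → ℕ → Set ℂ) : Prop :=
  (∀ p < ς, ∀ p' < χ p, ∃ θ1 θ2 : ℝ, θ1 < θ2 ∧ θ2 - θ1 ≤ 2 * Real.pi ∧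
      E p p' = planarSector θ1 θ2 eps0) ∧
  (∀ p < ς, ∀ p' < χ p,
      (E p p' ∩ E (nextIdx ς χ p p').1 (nextIdx ς χ p p').2).Nonempty) ∧
  (∀ p1 < ς, ∀ q1 < χ p1, ∀ p2 < ς, ∀ q2 < χ p2, ∀ p3 < ς, ∀ q3 < χ p3,
      (p1, q1) ≠ (p2, q2) → (p1, q1) ≠ (p3, q3) → (p2, q2) ≠ (p3, q3) →
      E p1 q1 ∩ E p2 q2 ∩ E p3 q3 = ∅) ∧
  (⋃ p ∈ Finset.range ς, ⋃ p' ∈ Finset.range (χ p), E p p')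
    = Metric.ball (0 : ℂ) eps0 \ {0}

open MeasureTheory Filter Topology Set Metric in
theorem rs_param {E : Type*} [NormedAddCommGroup E] [NormedSpace ℂ E] [CompleteSpace E]
    (μ : Measure ℝ) [IsFiniteMeasure μ] (F : ℂ → ℝ → E) (z0 : ℂ) (ε B : ℝ) (hε : 0 < ε)
    (hm : ∀ z ∈ ball z0 ε, AEStronglyMeasurable (F z) μ)
    (hd : ∀ᵐ x ∂μ, DifferentiableOn ℂ (fun z => F z x) (ball z0 ε))
    (hB : ∀ᵐ x ∂μ, ∀ z ∈ ball z0 ε, ‖F z x‖ ≤ B) :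
    DifferentiableAt ℂ (fun z => ∫ x, F z x ∂μ) z0 := by
  have hz0 : z0 ∈ ball z0 ε := mem_ball_self hε
  have key := hasDerivAt_integral_of_dominated_loc_of_deriv_le (μ := μ) (𝕜 := ℂ) (F := F)
    (x₀ := z0) (s := ball z0 (ε/2)) (bound := fun _ => B / (ε/4))
    (F' := fun z x => deriv (fun z => F z x) z)
    (ball_mem_nhds _ (by positivity)) ?_ ?_ ?_ ?_ ?_ ?_
  · exact key.2.differentiableAt
  · filter_upwards [ball_mem_nhds z0 hε] with z hz using hm z hz
  · refine Integrable.of_bound (hm z0 hz0) B ?_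
    filter_upwards [hB] with x hx using hx z0 hz0
  · let t : ℕ → ℂ := fun n => ((ε/2 * (1/((n:ℝ)+1)) : ℝ) : ℂ)
    have htpos : ∀ n : ℕ, 0 < ε/2 * (1/((n:ℝ)+1)) := fun n => by positivity
    have ht : Tendsto t atTop (𝓝[≠] 0) := by
      refine tendsto_nhdsWithin_iff.2 ⟨?_, Eventually.of_forall fun n => ?_⟩
      · have : Tendsto (fun n : ℕ => ε/2 * (1/((n:ℝ)+1))) atTop (𝓝 (ε/2 * 0)) :=
          tendsto_one_div_add_atTop_nhds_zero_nat.const_mul _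
        rw [mul_zero] at this
        have h2 := (Complex.continuous_ofReal.tendsto 0).comp this
        simpa [t, Function.comp_def] using h2
      · simp only [t, mem_compl_iff, mem_singleton_iff, Complex.ofReal_eq_zero]
        exact (htpos n).ne'
    have htb : ∀ n, z0 + t n ∈ ball z0 ε := fun n => by
      rw [mem_ball, dist_eq_norm, add_sub_cancel_left, Complex.norm_real, Real.norm_eq_abs,
        abs_of_pos (htpos n)]
      have : 1/((n:ℝ)+1) ≤ 1 := by
        rw [div_le_one (by positivity)]
        have : (0:ℝ) ≤ n := by positivity
        linarith
      nlinarith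
    refine aestronglyMeasurable_of_tendsto_ae (u := atTop)
      (f := fun n x => (t n)⁻¹ • (F (z0 + t n) x - F z0 x)) (fun n => ?_) ?_
    · exact ((hm _ (htb n)).sub (hm _ hz0)).const_smul _
    · filter_upwards [hd] with x hx
      have h1 : HasDerivAt (fun z => F z x) (deriv (fun z => F z x) z0) z0 :=
        (hx.differentiableAt (ball_mem_nhds _ hε)).hasDerivAt
      exact (hasDerivAt_iff_tendsto_slope_zero.1 h1).comp ht
  · filter_upwards [hd, hB] with x hx hx2 z hz
    have hsub : closedBall z (ε/4) ⊆ ball z0 ε := by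
      intro w hw
      rw [mem_closedBall] at hw
      rw [mem_ball] at hz ⊢
      linarith [dist_triangle w z z0]
    refine Complex.norm_deriv_le_of_forall_mem_sphere_norm_le (by positivity) ?_ ?_
    · exact (hx.mono hsub).diffContOnCl_ball Subset.rfl
    · intro w hw
      exact hx2 w (hsub (sphere_subset_closedBall hw))
  · exact integrable_const _
  · filter_upwards [hd] with x hx z hz
    refine (hx.differentiableAt ?_).hasDerivAt
    exact isOpen_ball.mem_nhds (ball_subset_ball (by linarith) hz)

/-- open sector around the positive reals -/
def rsS (R h : ℝ) : Set ℂ := {z : ℂ | z ≠ 0 ∧ ‖z‖ < R ∧ |z.arg| < h}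

theorem rsS_slit {R h : ℝ} (h1 : h ≤ 1) {z : ℂ} (hz : z ∈ rsS R h) : z ∈ Complex.slitPlane := by
  rw [Complex.mem_slitPlane_iff_arg]
  refine ⟨fun h => ?_, hz.1⟩
  have := hz.2.2
  rw [h, abs_of_pos Real.pi_pos] at this
  linarith [Real.pi_gt_three]

theorem rsS_open {R h : ℝ} (h1 : h ≤ 1) : IsOpen (rsS R h) := by
  rw [isOpen_iff_mem_nhds]
  intro z hz
  have hc : ContinuousAt (fun z : ℂ => |z.arg|) z := (Complex.continuousAt_arg (rsS_slit h1 hz)).abs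
  filter_upwards [isOpen_ne.mem_nhds hz.1, (continuous_norm.continuousAt (x := z)).eventually_lt_const hz.2.1,
    hc.eventually_lt_const hz.2.2] with w h1 h2 h3 using ⟨h1, h2, h3⟩

theorem rsS_real {R h x : ℝ} (hh : 0 < h) (hx : x ∈ Set.Ioo 0 R) : (x : ℂ) ∈ rsS R h := by
  refine ⟨by exact_mod_cast hx.1.ne', ?_, ?_⟩
  · rw [Complex.norm_real, Real.norm_eq_abs, abs_of_pos hx.1]; exact hx.2
  · rw [Complex.arg_ofReal_of_nonneg hx.1.le]; simpa using hh

theorem rsS_im_pos {R h : ℝ} (h1 : h ≤ 1) {z : ℂ} (hz : z ∈ rsS R h) : 0 < z.re := by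
  have := hz.2.2
  have h2 : |z.arg| < Real.pi / 2 := by linarith [Real.pi_gt_three]
  rcases Complex.abs_arg_lt_pi_div_two_iff.1 h2 with h | h
  · exact h
  · exact absurd h hz.1

theorem rsS_preconn {R h : ℝ} (h1 : h ≤ 1) : IsPreconnected (rsS R h) := by
  have : rsS R h = Complex.exp '' (Set.Iio (Real.log R) ×ℂ Set.Ioo (-h) h ∩ {w | 0 < R}) := by
    ext z
    constructor
    · intro hz
      refine ⟨Complex.log z, ⟨⟨?_, ?_⟩, ?_⟩, Complex.exp_log hz.1⟩
      · simp only [Set.mem_preimage, Complex.log_re, Set.mem_Iio]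
        exact Real.log_lt_log (norm_pos_iff.2 hz.1) hz.2.1
      · simp only [Set.mem_preimage, Complex.log_im]
        exact abs_lt.1 hz.2.2
      · exact (norm_nonneg z).trans_lt hz.2.1
    · rintro ⟨w, ⟨⟨hw1, hw2⟩, hR⟩, rfl⟩
      simp only [Set.mem_preimage, Set.mem_Iio, Set.mem_ofPred_eq] at hw1 hR
      refine ⟨Complex.exp_ne_zero _, ?_, ?_⟩
      · rw [Complex.norm_exp]
        exact (Real.lt_log_iff_exp_lt hR).1 hw1
      · simp only [Set.mem_preimage, Set.mem_Ioo] at hw2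
        rw [Complex.arg_exp, (toIocMod_eq_self _).2]
        · exact abs_lt.2 hw2
        · constructor <;> linarith [Real.pi_gt_three, hw2.1, hw2.2]
  rw [this]
  refine IsPreconnected.image ?_ _ Complex.continuous_exp.continuousOn
  by_cases hR : 0 < R
  · simp only [hR, Set.ofPred_true, Set.inter_univ]
    exact (((convex_Iio (𝕜 := ℝ) _).linear_preimage Complex.reLm).inter
      ((convex_Ioo (𝕜 := ℝ) _ _).linear_preimage Complex.imLm)).isPreconnected
  · simp [hR, isPreconnected_empty]

/-- proportional balls stay within the sector -/
theorem rsS_ball {R h r h' : ℝ} (h1 : h ≤ 1) (hr : r < R) (hR : 0 < R) (hh : h' < h) :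
    ∃ c : ℝ, 0 < c ∧ c < 1/2 ∧ ∀ z ∈ rsS r h', Metric.ball z (c * ‖z‖) ⊆ rsS R h := by
  have hc : ContinuousAt (fun z : ℂ => |z.arg|) 1 := (Complex.continuousAt_arg (by simp)).abs
  have h3 : ∀ᶠ τ : ℂ in nhds 1, |τ.arg| < h - h' :=
    hc.eventually_lt_const (by simpa using hh)
  rcases Metric.eventually_nhds_iff_ball.1 h3 with ⟨c0, hc0, hball⟩
  by_cases hrpos : 0 < r
  swap
  · refine ⟨1/4, by norm_num, by norm_num, fun z hz => ?_⟩
    exact absurd ((norm_nonneg z).trans_lt hz.2.1) hrpos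
  refine ⟨min c0 (min (1/4) ((R-r)/r)), ?_, ?_, ?_⟩
  · have : 0 < (R-r)/r := div_pos (by linarith) hrpos
    positivity
  · have := min_le_right c0 (min (1/4) ((R-r)/r))
    have := min_le_left (1/4) ((R-r)/r)
    linarith
  · intro z hz w hw
    set c := min c0 (min (1/4) ((R-r)/r)) with hcdef
    have hz0 : 0 < ‖z‖ := norm_pos_iff.2 hz.1
    have c1 : c ≤ c0 := min_le_left _ _
    have c2 : c ≤ 1/4 := (min_le_right _ _).trans (min_le_left _ _)
    have c3 : c ≤ (R-r)/r := (min_le_right _ _).trans (min_le_right _ _)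
    rw [Metric.mem_ball, dist_eq_norm] at hw
    have hw0 : w ≠ 0 := by
      rintro rfl
      rw [zero_sub, norm_neg] at hw
      nlinarith
    have hq : ‖w / z - 1‖ < c := by
      have : w / z - 1 = (w - z) / z := by rw [sub_div, div_self hz.1]
      rw [this, norm_div, div_lt_iff₀ hz0]; exact hw
    have hq2 : |(w/z).arg| < h - h' := hball _ (by rw [Metric.mem_ball, dist_eq_norm]; linarith)
    have hwz : w = z * (w / z) := by field_simp [hz.1]
    have hz2 := hz.2.2
    refine ⟨hw0, ?_, ?_⟩
    · have e1 : ‖w‖ ≤ ‖z‖ + ‖w - z‖ := by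
        calc ‖w‖ = ‖z + (w - z)‖ := by congr 1; ring
          _ ≤ _ := norm_add_le _ _
      have e2 : c * ‖z‖ ≤ (R - r)/r * r := by
        apply mul_le_mul c3 hz.2.1.le (norm_nonneg _)
        exact (div_pos (by linarith) hrpos).le
      rw [div_mul_cancel₀ _ hrpos.ne'] at e2
      linarith [hz.2.1]
    · have habs := abs_add_le z.arg (w/z).arg
      have : w.arg = z.arg + (w/z).arg := by
        conv_lhs => rw [hwz]
        apply Complex.arg_mul hz.1 (div_ne_zero hw0 hz.1)
        have := abs_le.1 habs
        constructor <;> linarith [Real.pi_gt_three, this.1, this.2]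
      rw [this]
      linarith

open MeasureTheory in
noncomputable def rsPhi {E : Type*} [NormedAddCommGroup E] [NormedSpace ℂ E]
    (R : ℝ) (g : ℂ → E) (z : ℂ) : E :=
  (2 * Real.pi * Complex.I : ℂ)⁻¹ • ∫ x in Set.Ioo 0 R, ((x : ℂ) - z)⁻¹ • g x

open MeasureTheory in
noncomputable def rsPlus {E : Type*} [NormedAddCommGroup E] [NormedSpace ℂ E]
    (R : ℝ) (g : ℂ → E) (z : ℂ) : E :=
  (2 * Real.pi * Complex.I : ℂ)⁻¹ • ((∫ x in Set.Ioo 0 R, dslope g (x : ℂ) z)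
    + (Complex.log (R - z) - Complex.log z) • g z) + (1/2 : ℂ) • g z

open MeasureTheory in
noncomputable def rsB {E : Type*} [NormedAddCommGroup E] [NormedSpace ℂ E]
    (R : ℝ) (g : ℂ → E) : E :=
  (2 * Real.pi * Complex.I : ℂ)⁻¹ • ∫ x in Set.Ioo 0 R, (x : ℂ)⁻¹ • g x

structure RsHyp {E : Type*} [NormedAddCommGroup E] [NormedSpace ℂ E]
    (R h B : ℝ) (g : ℂ → E) : Prop where
  hR : 0 < R
  hh : 0 < h
  h1 : h ≤ 1
  hB : 0 ≤ B
  hd : DifferentiableOn ℂ g (rsS R h)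
  hb : ∀ z ∈ rsS R h, ‖g z‖ ≤ B * ‖z‖

theorem rs_dslope_comm {E : Type*} [NormedAddCommGroup E] [NormedSpace ℂ E] (g : ℂ → E) (x z : ℂ) :
    dslope g x z = dslope g z x := by
  by_cases h : x = z
  · rw [h]
  · rw [dslope_of_ne _ (Ne.symm h), dslope_of_ne _ h, slope_comm]

theorem rs_dslope_bound {R h r h' : ℝ} (h1 : h ≤ 1) (hr : r < R) (hR : 0 < R) (hh : h' < h) :
    ∃ K : ℝ, 0 ≤ K ∧ ∀ {E : Type*} [NormedAddCommGroup E] [NormedSpace ℂ E] (B : ℝ) (g : ℂ → E),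
      RsHyp R h B g → ∀ z ∈ rsS r h', ∀ x ∈ Set.Ioo 0 R, ‖dslope g (x : ℂ) z‖ ≤ K * B := by
  obtain ⟨c, hc0, hc1, hc⟩ := rsS_ball h1 hr hR hh
  refine ⟨4 / c + 1, by positivity, ?_⟩
  intro E _ _ B g H z hz x hx
  have hz0 : 0 < ‖z‖ := norm_pos_iff.2 hz.1
  have hzS : z ∈ rsS R h := hc z hz (Metric.mem_ball_self (by positivity))
  have hB := H.hB
  have hgz := H.hb z hzS
  rw [rs_dslope_comm]
  by_cases hxz : ‖(x : ℂ) - z‖ < c * ‖z‖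
  · have h2 := Complex.norm_dslope_le_div_of_mapsTo_ball (f := g) (c := z) (R₁ := c * ‖z‖)
      (R₂ := 4 * B * ‖z‖) (z := (x:ℂ)) (H.hd.mono (hc z hz)) ?_ (by rwa [Metric.mem_ball, dist_eq_norm])
    · calc _ ≤ _ := h2
        _ = 4 / c * B := by field_simp
        _ ≤ _ := by nlinarith
    · intro w hw
      have hgw := H.hb w (hc z hz hw)
      rw [Metric.mem_ball, dist_eq_norm] at hw
      have e1 : ‖w‖ ≤ ‖z‖ + ‖w - z‖ := by
        calc ‖w‖ = ‖z + (w - z)‖ := by congr 1; ring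
          _ ≤ _ := norm_add_le _ _
      rw [Metric.mem_closedBall, dist_eq_norm]
      have := norm_sub_le (g w) (g z)
      have e2 : ‖w‖ ≤ 2 * ‖z‖ := by nlinarith
      have := mul_le_mul_of_nonneg_left e2 hB
      nlinarith [mul_nonneg hB hz0.le]
  · push Not at hxz
    have hpos : 0 < ‖(x:ℂ) - z‖ := lt_of_lt_of_le (by positivity) hxz
    have hne : (x : ℂ) ≠ z := fun h => by rw [h] at hpos; simp at hpos
    rw [dslope_of_ne _ hne, slope_def_module, norm_smul, norm_inv, inv_mul_le_iff₀ hpos]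
    have hgx := H.hb x (rsS_real H.hh hx)
    have := norm_sub_le (g x) (g z)
    have e1 : ‖(x:ℂ)‖ ≤ ‖z‖ + ‖(x:ℂ) - z‖ := by
      calc ‖(x:ℂ)‖ = ‖z + ((x:ℂ) - z)‖ := by congr 1; ring
        _ ≤ _ := norm_add_le _ _
    have e3 : ‖z‖ ≤ ‖(x:ℂ) - z‖ / c := by rw [le_div_iff₀ hc0]; linarith
    have e4 : ‖g x - g z‖ ≤ B * (‖(x:ℂ) - z‖ + 2 * (‖(x:ℂ) - z‖ / c)) := by
      calc _ ≤ B * ‖(x:ℂ)‖ + B * ‖z‖ := by linarith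
        _ = B * (‖(x:ℂ)‖ + ‖z‖) := by ring
        _ ≤ _ := mul_le_mul_of_nonneg_left (by linarith) hB
    calc _ ≤ _ := e4
      _ ≤ B * (‖(x:ℂ) - z‖ + 4 * (‖(x:ℂ) - z‖ / c)) := by
          apply mul_le_mul_of_nonneg_left _ hB
          have : 0 ≤ ‖(x:ℂ) - z‖ / c := by positivity
          linarith
      _ = _ := by ring

open MeasureTheory in
theorem rs_dslope_meas {E : Type*} [NormedAddCommGroup E] [NormedSpace ℂ E] {R h B : ℝ} {g : ℂ → E}
    (H : RsHyp R h B g) (z : ℂ) :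
    AEStronglyMeasurable (fun x : ℝ => dslope g (x : ℂ) z) (volume.restrict (Set.Ioo 0 R)) := by
  have hg : AEStronglyMeasurable (fun x : ℝ => g x) (volume.restrict (Set.Ioo 0 R)) := by
    refine ContinuousOn.aestronglyMeasurable ?_ measurableSet_Ioo
    exact H.hd.continuousOn.comp Complex.continuous_ofReal.continuousOn
      (fun x hx => rsS_real H.hh hx)
  have hm : AEStronglyMeasurable (fun x : ℝ => (z - (x:ℂ))⁻¹ • (g z - g x))
      (volume.restrict (Set.Ioo 0 R)) := by
    refine AEStronglyMeasurable.smul ?_ (aestronglyMeasurable_const.sub hg)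
    have : Measurable (fun x : ℝ => (z - (x:ℂ))⁻¹) := by fun_prop
    exact this.aestronglyMeasurable
  refine hm.congr ?_
  have : ∀ᵐ x : ℝ ∂(volume.restrict (Set.Ioo 0 R)), x ≠ z.re :=
    ae_restrict_of_ae (Measure.ae_ne volume z.re)
  filter_upwards [this] with x hx
  have hne : z ≠ (x:ℂ) := by rintro rfl; simp at hx
  rw [dslope_of_ne _ hne, slope_def_module]

open MeasureTheory in
theorem rs_g_meas {E : Type*} [NormedAddCommGroup E] [NormedSpace ℂ E] {R h B : ℝ} {g : ℂ → E}
    (H : RsHyp R h B g) (z : ℂ) :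
    AEStronglyMeasurable (fun x : ℝ => ((x : ℂ) - z)⁻¹ • g x) (volume.restrict (Set.Ioo 0 R)) := by
  have hg : AEStronglyMeasurable (fun x : ℝ => g x) (volume.restrict (Set.Ioo 0 R)) := by
    refine ContinuousOn.aestronglyMeasurable ?_ measurableSet_Ioo
    exact H.hd.continuousOn.comp Complex.continuous_ofReal.continuousOn
      (fun x hx => rsS_real H.hh hx)
  refine AEStronglyMeasurable.smul ?_ hg
  have : Measurable (fun x : ℝ => ((x:ℂ) - z)⁻¹) := by fun_prop
  exact this.aestronglyMeasurable

theorem rs_log_slit {R : ℝ} {z : ℂ} (hz : ‖z‖ < R) : (R - z : ℂ) ∈ Complex.slitPlane := by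
  left
  have := Complex.re_le_norm z
  simp only [Complex.sub_re, Complex.ofReal_re]; linarith

open MeasureTheory in
theorem rsPlus_diff {E : Type*} [NormedAddCommGroup E] [NormedSpace ℂ E] [CompleteSpace E]
    {R h B : ℝ} {g : ℂ → E} (H : RsHyp R h B g) : DifferentiableOn ℂ (rsPlus R g) (rsS R h) := by
  intro z0 hz0
  apply DifferentiableAt.differentiableWithinAt
  have hgd : DifferentiableAt ℂ g z0 := H.hd.differentiableAt ((rsS_open H.h1).mem_nhds hz0)
  have hI : DifferentiableAt ℂ (fun z => ∫ x in Set.Ioo 0 R, dslope g (x : ℂ) z) z0 := by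
    obtain ⟨r, hr1, hr2⟩ := exists_between hz0.2.1
    obtain ⟨h', hr3, hr4⟩ := exists_between hz0.2.2
    obtain ⟨K, hK, hKb⟩ := rs_dslope_bound H.h1 hr2 H.hR hr4
    have hz0' : z0 ∈ rsS r h' := ⟨hz0.1, hr1, hr3⟩
    have hop : IsOpen (rsS r h') := rsS_open (hr4.le.trans H.h1)
    obtain ⟨ε, hε, hball⟩ := Metric.isOpen_iff.1 hop z0 hz0'
    have hsub : rsS r h' ⊆ rsS R h := fun z hz => ⟨hz.1, hz.2.1.trans hr2, hz.2.2.trans hr4⟩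
    refine rs_param _ _ z0 ε (K * B) hε (fun z _ => rs_dslope_meas H z) ?_ ?_
    · filter_upwards [ae_restrict_mem measurableSet_Ioo] with x hx
      have hxS : rsS R h ∈ nhds (x:ℂ) := (rsS_open H.h1).mem_nhds (rsS_real H.hh hx)
      exact ((Complex.differentiableOn_dslope hxS).2 H.hd).mono (hball.trans hsub)
    · filter_upwards [ae_restrict_mem measurableSet_Ioo] with x hx z hz
      exact hKb B g H z (hball hz) x hx
  have hl1 : DifferentiableAt ℂ (fun z : ℂ => Complex.log (R - z)) z0 :=
    (DifferentiableAt.clog (by fun_prop) (rs_log_slit hz0.2.1))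
  have hl2 : DifferentiableAt ℂ Complex.log z0 := Complex.differentiableAt_log (rsS_slit H.h1 hz0)
  unfold rsPlus
  exact ((hI.add ((hl1.sub hl2).smul hgd)).const_smul _).add (hgd.const_smul _)

theorem rs_off {R : ℝ} {z : ℂ} (hz : z.arg ≠ 0) :
    ∃ ε > 0, ∀ w ∈ Metric.ball z ε, ∀ x ∈ Set.Ioo 0 R, ε ≤ ‖(x:ℂ) - w‖ := by
  have hclosed : IsClosed ((fun x : ℝ => (x:ℂ)) '' Set.Icc 0 R) :=
    (isCompact_Icc.image Complex.continuous_ofReal).isClosed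
  have hz' : z ∈ ((fun x : ℝ => (x:ℂ)) '' Set.Icc 0 R)ᶜ := by
    rintro ⟨x, hx, rfl⟩
    exact hz (Complex.arg_ofReal_of_nonneg hx.1)
  obtain ⟨ε, hε, hb⟩ := Metric.isOpen_iff.1 hclosed.isOpen_compl z hz'
  refine ⟨ε / 2, by positivity, fun w hw x hx => ?_⟩
  by_contra hcon
  push Not at hcon
  have : (x:ℂ) ∈ Metric.ball z ε := by
    rw [Metric.mem_ball] at hw ⊢
    rw [← dist_eq_norm] at hcon
    linarith [dist_triangle (x:ℂ) w z]
  exact hb this ⟨x, ⟨hx.1.le, hx.2.le⟩, rfl⟩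

theorem rs_gx {E : Type*} [NormedAddCommGroup E] [NormedSpace ℂ E] {R h B : ℝ} {g : ℂ → E}
    (H : RsHyp R h B g) {x : ℝ} (hx : x ∈ Set.Ioo 0 R) : ‖g x‖ ≤ B * x := by
  have := H.hb x (rsS_real H.hh hx)
  rwa [Complex.norm_real, Real.norm_eq_abs, abs_of_pos hx.1] at this

open MeasureTheory in
theorem rsPhi_diff {E : Type*} [NormedAddCommGroup E] [NormedSpace ℂ E] [CompleteSpace E]
    {R h B : ℝ} {g : ℂ → E} (H : RsHyp R h B g) {z0 : ℂ} (hz : z0.arg ≠ 0) :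
    DifferentiableAt ℂ (rsPhi R g) z0 := by
  obtain ⟨ε, hε, hb⟩ := rs_off (R := R) hz
  unfold rsPhi
  refine DifferentiableAt.const_smul ?_ _
  refine rs_param _ _ z0 ε (ε⁻¹ * (B * R)) hε (fun z _ => rs_g_meas H z) ?_ ?_
  · filter_upwards [ae_restrict_mem measurableSet_Ioo] with x hx z hz
    have : (x:ℂ) - z ≠ 0 := norm_pos_iff.1 (hε.trans_le (hb z hz x hx))
    have h2 : DifferentiableAt ℂ (fun z : ℂ => ((x:ℂ) - z)⁻¹) z := by fun_prop (disch := exact this)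
    exact (h2.smul_const _).differentiableWithinAt
  · filter_upwards [ae_restrict_mem measurableSet_Ioo] with x hx z hz
    rw [norm_smul, norm_inv]
    have h1 := hb z hz x hx
    have h2 := rs_gx H hx
    have h3 : B * x ≤ B * R := mul_le_mul_of_nonneg_left hx.2.le H.hB
    gcongr
    linarith

open MeasureTheory in
theorem rs_integrable {E : Type*} [NormedAddCommGroup E] [NormedSpace ℂ E] [CompleteSpace E]
    {R h B : ℝ} {g : ℂ → E} (H : RsHyp R h B g) {z : ℂ} (hz : z.arg ≠ 0) :
    IntegrableOn (fun x : ℝ => ((x : ℂ) - z)⁻¹ • g x) (Set.Ioo 0 R) := by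
  obtain ⟨ε, hε, hb⟩ := rs_off (R := R) hz
  refine Integrable.of_bound (rs_g_meas H z) (ε⁻¹ * (B * R)) ?_
  filter_upwards [ae_restrict_mem measurableSet_Ioo] with x hx
  rw [norm_smul, norm_inv]
  have h1 := hb z (Metric.mem_ball_self hε) x hx
  have h2 := rs_gx H hx
  have h3 : B * x ≤ B * R := mul_le_mul_of_nonneg_left hx.2.le H.hB
  gcongr
  linarith

open MeasureTheory in
theorem rs_integrable0 {E : Type*} [NormedAddCommGroup E] [NormedSpace ℂ E] [CompleteSpace E]
    {R h B : ℝ} {g : ℂ → E} (H : RsHyp R h B g)  :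
    IntegrableOn (fun x : ℝ => (x : ℂ)⁻¹ • g x) (Set.Ioo 0 R) := by
  have hm := rs_g_meas H 0
  simp only [sub_zero] at hm
  refine Integrable.of_bound hm B ?_
  filter_upwards [ae_restrict_mem measurableSet_Ioo] with x hx
  rw [norm_smul, norm_inv, Complex.norm_real, Real.norm_eq_abs, abs_of_pos hx.1,
    inv_mul_le_iff₀ hx.1]
  linarith [rs_gx H hx]

open MeasureTheory in
/-- the kernel integral -/
theorem rs_kernel {R : ℝ} (hR : 0 < R) {z : ℂ} (hz : z.im ≠ 0) :
    IntegrableOn (fun x : ℝ => ((x : ℂ) - z)⁻¹) (Set.Ioo 0 R) ∧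
    ∫ x in Set.Ioo 0 R, ((x : ℂ) - z)⁻¹ = Complex.log (R - z) - Complex.log (-z) := by
  have hne : ∀ x : ℝ, (x:ℂ) - z ≠ 0 := fun x h => hz (by
    have := congrArg Complex.im h
    simpa using this)
  have hcont : Continuous (fun x : ℝ => ((x : ℂ) - z)⁻¹) := by
    refine Continuous.inv₀ (by fun_prop) hne
  have hi : IntervalIntegrable (fun x : ℝ => ((x : ℂ) - z)⁻¹) volume 0 R := hcont.intervalIntegrable _ _
  refine ⟨(hcont.integrableOn_Icc).mono_set Set.Ioo_subset_Icc_self, ?_⟩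
  have := intervalIntegral.integral_eq_sub_of_hasDerivAt (a := 0) (b := R)
    (f := fun x : ℝ => Complex.log ((x:ℂ) - z)) (f' := fun x : ℝ => ((x : ℂ) - z)⁻¹) ?_ hi
  · rw [intervalIntegral.integral_of_le hR.le, integral_Ioc_eq_integral_Ioo] at this
    rw [this]; simp
  · intro x _
    have h1 : HasDerivAt (fun x : ℝ => (x:ℂ) - z) 1 x := by
      simpa using (Complex.ofRealCLM.hasDerivAt (x := x)).sub_const z
    have h2 := h1.clog_real (Or.inr (by simpa using hz))
    simpa [one_div] using h2

open MeasureTheory in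
theorem rs_split {E : Type*} [NormedAddCommGroup E] [NormedSpace ℂ E] [CompleteSpace E]
    {R h B : ℝ} {g : ℂ → E} (H : RsHyp R h B g) {z : ℂ} (hz : z.im ≠ 0) :
    ∫ x in Set.Ioo 0 R, dslope g (x:ℂ) z = (∫ x in Set.Ioo 0 R, ((x : ℂ) - z)⁻¹ • g x)
      - (Complex.log (R - z) - Complex.log (-z)) • g z := by
  have harg : z.arg ≠ 0 := fun h => hz (Complex.arg_eq_zero_iff.1 h).2
  obtain ⟨hk1, hk2⟩ := rs_kernel H.hR hz
  rw [← hk2, ← integral_smul_const, ← integral_sub (rs_integrable H harg) (hk1.smul_const _)]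
  refine setIntegral_congr_fun measurableSet_Ioo fun x hx => ?_
  have hne : (x:ℂ) ≠ z := by rintro rfl; simp at hz
  rw [rs_dslope_comm, dslope_of_ne _ hne, slope_def_module, smul_sub]

theorem rs_2pi : (2 * Real.pi * Complex.I : ℂ) ≠ 0 := by
  simp [Real.pi_ne_zero, Complex.I_ne_zero]

theorem rs_plus_pos {E : Type*} [NormedAddCommGroup E] [NormedSpace ℂ E] [CompleteSpace E]
    {R h B : ℝ} {g : ℂ → E} (H : RsHyp R h B g) {z : ℂ} (hz : 0 < z.im) :
    rsPlus R g z = rsPhi R g z := by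
  unfold rsPlus rsPhi
  rw [rs_split H hz.ne']
  have hlog : Complex.log (-z) = Complex.log z - Real.pi * Complex.I := by
    unfold Complex.log
    rw [norm_neg, Complex.arg_neg_eq_arg_sub_pi_of_im_pos hz]
    push_cast; ring
  rw [hlog]
  have h2 := rs_2pi
  generalize ∫ x in Set.Ioo 0 R, ((x : ℂ) - z)⁻¹ • g x = W
  have : (1/2 : ℂ) = (2 * Real.pi * Complex.I : ℂ)⁻¹ * (Real.pi * Complex.I) := by
    have : (Real.pi : ℂ) ≠ 0 := by exact_mod_cast Real.pi_ne_zero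
    field_simp [Complex.I_ne_zero]
  rw [this, mul_smul, ← smul_add]
  congr 1
  module

theorem rs_plus_neg {E : Type*} [NormedAddCommGroup E] [NormedSpace ℂ E] [CompleteSpace E]
    {R h B : ℝ} {g : ℂ → E} (H : RsHyp R h B g) {z : ℂ} (hz : z.im < 0) :
    rsPlus R g z = rsPhi R g z + g z := by
  unfold rsPlus rsPhi
  rw [rs_split H hz.ne]
  have hlog : Complex.log (-z) = Complex.log z + Real.pi * Complex.I := by
    unfold Complex.log
    rw [norm_neg, Complex.arg_neg_eq_arg_add_pi_of_im_neg hz]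
    push_cast; ring
  rw [hlog]
  have h2 := rs_2pi
  generalize ∫ x in Set.Ioo 0 R, ((x : ℂ) - z)⁻¹ • g x = W
  have : (1/2 : ℂ) = (2 * Real.pi * Complex.I : ℂ)⁻¹ * (Real.pi * Complex.I) := by
    have : (Real.pi : ℂ) ≠ 0 := by exact_mod_cast Real.pi_ne_zero
    field_simp [Complex.I_ne_zero]
  have h3 : g z = (2 * Real.pi * Complex.I : ℂ)⁻¹ • ((2 * Real.pi * Complex.I : ℂ) • g z) := by
    rw [smul_smul, inv_mul_cancel₀ h2, one_smul]
  conv_rhs => rw [h3]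
  rw [this, mul_smul, ← smul_add, ← smul_add]
  congr 1
  module

theorem rs_dist {h : ℝ} (hh : 0 < h) (h1 : h ≤ 1) : ∃ c : ℝ, 0 < c ∧ ∀ z : ℂ, h ≤ |z.arg| →
    ∀ x : ℝ, 0 < x → c * x ≤ ‖(x:ℂ) - z‖ := by
  refine ⟨Real.sin h, Real.sin_pos_of_pos_of_lt_pi hh (by linarith [Real.pi_gt_three]), ?_⟩
  intro z hz x hx
  have hs : 0 < Real.sin h := Real.sin_pos_of_pos_of_lt_pi hh (by linarith [Real.pi_gt_three])
  have hcos : Real.cos z.arg ≤ Real.cos h := by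
    rw [← Real.cos_abs z.arg]
    exact Real.cos_le_cos_of_nonneg_of_le_pi hh.le (Complex.abs_arg_le_pi z) hz
  have hre : z.re = ‖z‖ * Real.cos z.arg := (Complex.norm_mul_cos_arg z).symm
  have hre2 : z.re ≤ ‖z‖ * Real.cos h := by
    rw [hre]; exact mul_le_mul_of_nonneg_left hcos (norm_nonneg _)
  refine abs_le_of_sq_le_sq' ?_ (norm_nonneg _) |>.2
  have e1 : ‖(x:ℂ) - z‖^2 = x^2 - 2 * x * z.re + ‖z‖^2 := by
    rw [← Complex.normSq_eq_norm_sq, ← Complex.normSq_eq_norm_sq, Complex.normSq_apply, Complex.normSq_apply]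
    simp; ring
  rw [e1]
  have h2 := Real.sin_sq_add_cos_sq h
  nlinarith [sq_nonneg (x * Real.cos h - ‖z‖), mul_le_mul_of_nonneg_left hre2 hx.le]

theorem rs_inv_2pi : ‖(2 * Real.pi * Complex.I : ℂ)⁻¹‖ ≤ 1 := by
  rw [norm_inv]
  apply inv_le_one_of_one_le₀
  simp only [norm_mul, Complex.norm_I, Complex.norm_real, mul_one, Complex.norm_ofNat,
    Real.norm_eq_abs, abs_of_pos Real.pi_pos]
  linarith [Real.pi_gt_three]

open MeasureTheory in
theorem rsPhi_bound {h : ℝ} (R : ℝ) (hR : 0 < R) (hh : 0 < h) (h1 : h ≤ 1) : ∃ K : ℝ, 0 ≤ K ∧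
    ∀ {E : Type*} [NormedAddCommGroup E] [NormedSpace ℂ E] (B h0 : ℝ) (g : ℂ → E),
      RsHyp R h0 B g → ∀ z : ℂ, h ≤ |z.arg| → ‖rsPhi R g z‖ ≤ K * B := by
  obtain ⟨c, hc, hcb⟩ := rs_dist hh h1
  refine ⟨c⁻¹ * R, by positivity, ?_⟩
  intro E _ _ B h0 g H z hz
  unfold rsPhi
  rw [norm_smul]
  have hB := H.hB
  have : ‖∫ x in Set.Ioo 0 R, ((x : ℂ) - z)⁻¹ • g x‖ ≤ c⁻¹ * B * volume.real (Set.Ioo 0 R) := by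
    refine norm_setIntegral_le_of_norm_le_const (by simp) ?_
    intro x hx
    have h3 := hcb z hz x hx.1
    have h4 : 0 < c * x := mul_pos hc hx.1
    rw [norm_smul, norm_inv, inv_mul_le_iff₀ (h4.trans_le h3)]
    have h5 := rs_gx H hx
    calc _ ≤ _ := h5
      _ = (c * x) * (c⁻¹ * B) := by field_simp
      _ ≤ _ := by gcongr
  have hv : volume.real (Set.Ioo 0 R) = R := by simp [hR.le]
  rw [hv] at this
  calc _ ≤ 1 * (c⁻¹ * B * R) := mul_le_mul rs_inv_2pi this (norm_nonneg _) zero_le_one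
    _ = _ := by ring

open MeasureTheory in
theorem rsPlus_bound {R h r h' : ℝ} (h1 : h ≤ 1) (hr : r < R) (hR : 0 < R) (hh : h' < h) :
    ∃ K : ℝ, 0 ≤ K ∧ ∀ {E : Type*} [NormedAddCommGroup E] [NormedSpace ℂ E] (B : ℝ) (g : ℂ → E),
      RsHyp R h B g → ∀ z ∈ rsS r h', ‖rsPlus R g z‖ ≤ K * B := by
  obtain ⟨K, hK, hKb⟩ := rs_dslope_bound h1 hr hR hh
  obtain ⟨K2, hK2⟩ := (isCompact_closedBall (0:ℂ) r).exists_bound_of_continuousOn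
    (f := fun z : ℂ => Complex.log (R - z)) (by
      intro z hz
      apply ContinuousAt.continuousWithinAt
      refine ContinuousAt.clog (by fun_prop) (rs_log_slit ?_)
      rw [mem_closedBall_zero_iff] at hz; linarith)
  refine ⟨K * R + (|K2| * R + (1 + R * R + Real.pi * R)) + R, by positivity, ?_⟩
  intro E _ _ B g H z hz
  have hB := H.hB
  have hz0 : 0 < ‖z‖ := norm_pos_iff.2 hz.1
  have hzR : ‖z‖ < R := hz.2.1.trans hr
  have hgz := H.hb z ⟨hz.1, hzR, hz.2.2.trans hh⟩
  have a1 : ‖∫ x in Set.Ioo 0 R, dslope g (x : ℂ) z‖ ≤ K * B * R := by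
    have := norm_setIntegral_le_of_norm_le_const (μ := volume) (s := Set.Ioo 0 R)
      (f := fun x : ℝ => dslope g (x : ℂ) z) (C := K * B) (by simp) (fun x hx => hKb B g H z hz x hx)
    have hv : volume.real (Set.Ioo 0 R) = R := by simp [hR.le]
    rwa [hv] at this
  have a2 : ‖Complex.log (R - z)‖ ≤ |K2| :=
    (hK2 z (by rw [mem_closedBall_zero_iff]; exact hz.2.1.le)).trans (le_abs_self _)
  have a3 : ‖Complex.log z‖ * ‖z‖ ≤ 1 + R * R + Real.pi * R := by
    have b1 : ‖Complex.log z‖ ≤ |Real.log ‖z‖| + Real.pi := by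
      unfold Complex.log
      refine (norm_add_le _ _).trans ?_
      rw [norm_mul, Complex.norm_I, mul_one, Complex.norm_real, Complex.norm_real]
      exact add_le_add le_rfl (Complex.abs_arg_le_pi z)
    have b2 : |Real.log ‖z‖| * ‖z‖ ≤ 1 + R * R := by
      rcases le_total ‖z‖ 1 with hl | hl
      · have := Real.abs_log_mul_self_lt ‖z‖ hz0 hl
        rw [abs_mul, abs_of_pos hz0] at this
        nlinarith
      · have := Real.log_le_self hz0.le
        rw [abs_of_nonneg (Real.log_nonneg hl)]
        have : Real.log ‖z‖ * ‖z‖ ≤ R * R := by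
          apply mul_le_mul (by linarith) hzR.le hz0.le hR.le
        linarith
    nlinarith [Real.pi_pos]
  have a4 : ‖(Complex.log (R - z) - Complex.log z) • g z‖ ≤ (|K2| * R + (1 + R * R + Real.pi * R)) * B := by
    rw [norm_smul]
    calc _ ≤ (‖Complex.log (R - z)‖ + ‖Complex.log z‖) * (B * ‖z‖) := by
          gcongr; exact norm_sub_le _ _
      _ = (‖Complex.log (R - z)‖ * ‖z‖ + ‖Complex.log z‖ * ‖z‖) * B := by ring
      _ ≤ _ := by gcongr
  have a5 : ‖(1/2 : ℂ) • g z‖ ≤ R * B := by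
    rw [norm_smul]
    have : ‖(1/2 : ℂ)‖ ≤ 1 := by norm_num
    calc _ ≤ 1 * (B * ‖z‖) := by gcongr
      _ ≤ _ := by nlinarith
  unfold rsPlus
  refine (norm_add_le _ _).trans ?_
  have a6 : ‖(2 * Real.pi * Complex.I : ℂ)⁻¹ • ((∫ x in Set.Ioo 0 R, dslope g (x : ℂ) z)
    + (Complex.log (R - z) - Complex.log z) • g z)‖ ≤ K * B * R + (|K2| * R + (1 + R * R + Real.pi * R)) * B := by
    rw [norm_smul]
    calc _ ≤ 1 * _ := mul_le_mul rs_inv_2pi ((norm_add_le _ _).trans (add_le_add a1 a4)) (norm_nonneg _) zero_le_one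
      _ = _ := one_mul _
  calc _ ≤ _ := add_le_add a6 a5
    _ = _ := by ring

open MeasureTheory in
theorem rsPhi_rec {E : Type*} [NormedAddCommGroup E] [NormedSpace ℂ E] [CompleteSpace E]
    {R h B B1 : ℝ} {g g1 : ℂ → E} (H : RsHyp R h B g) (H1 : RsHyp R h B1 g1)
    (he : ∀ z, g1 z = z⁻¹ • g z) {z : ℂ} (hz : z.arg ≠ 0) :
    rsPhi R g z = rsB R g + z • rsPhi R g1 z := by
  unfold rsPhi rsB
  rw [smul_comm z, ← smul_add, ← integral_smul z, ← integral_add (rs_integrable0 H)]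
  · congr 1
    refine setIntegral_congr_fun measurableSet_Ioo fun x hx => ?_
    simp only [he]
    have hx0 : (x:ℂ) ≠ 0 := by exact_mod_cast hx.1.ne'
    have hne : (x:ℂ) - z ≠ 0 := by
      intro h
      rw [sub_eq_zero] at h
      rw [← h] at hz
      exact hz (Complex.arg_ofReal_of_nonneg hx.1.le)
    rw [smul_smul, smul_smul, ← add_smul]
    congr 1
    field_simp
    ring
  · exact (rs_integrable H1 hz).smul z

theorem rsPlus_rec {E : Type*} [NormedAddCommGroup E] [NormedSpace ℂ E] [CompleteSpace E]
    {R h B B1 : ℝ} {g g1 : ℂ → E} (H : RsHyp R h B g) (H1 : RsHyp R h B1 g1)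
    (he : ∀ z, g1 z = z⁻¹ • g z) {z : ℂ} (hz : z ∈ rsS R h) :
    rsPlus R g z = rsB R g + z • rsPlus R g1 z := by
  have hop := rsS_open (R := R) H.h1
  have d1 : AnalyticOnNhd ℂ (rsPlus R g) (rsS R h) := (rsPlus_diff H).analyticOnNhd hop
  have d2 : AnalyticOnNhd ℂ (fun z => rsB R g + z • rsPlus R g1 z) (rsS R h) := by
    refine DifferentiableOn.analyticOnNhd ?_ hop
    exact (differentiableOn_const _).add (differentiableOn_id.smul (rsPlus_diff H1))
  let z0 : ℂ := ((R/2 : ℝ) : ℂ) * Complex.exp ((h/2 : ℝ) * Complex.I)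
  have hR := H.hR
  have hh := H.hh
  have hh1 := H.h1
  have hz0arg : z0.arg = h/2 := by
    have : z0 = ((R/2 : ℝ) : ℂ) * (Complex.cos (h/2 : ℝ) + Complex.sin (h/2:ℝ) * Complex.I) := by
      simp only [z0]; rw [Complex.exp_mul_I]
    rw [this]
    apply Complex.arg_mul_cos_add_sin_mul_I (by positivity)
    constructor <;> linarith [Real.pi_gt_three]
  have hz0n : ‖z0‖ = R/2 := by
    simp only [z0, norm_mul, Complex.norm_exp_ofReal_mul_I, Complex.norm_real, mul_one]
    exact abs_of_pos (by positivity)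
  have hz0 : z0 ∈ rsS R h := by
    refine ⟨norm_pos_iff.1 (by rw [hz0n]; positivity), by rw [hz0n]; linarith, ?_⟩
    rw [hz0arg, abs_of_pos (by positivity)]; linarith
  have hz0im : 0 < z0.im := by
    rw [← Complex.norm_mul_sin_arg, hz0n, hz0arg]
    have := Real.sin_pos_of_pos_of_lt_pi (x := h/2) (by positivity) (by linarith [Real.pi_gt_three])
    positivity
  refine d1.eqOn_of_preconnected_of_eventuallyEq d2 (rsS_preconn H.h1) hz0 ?_ hz
  have : ∀ᶠ w : ℂ in nhds z0, 0 < w.im :=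
    Complex.continuous_im.continuousAt.eventually_const_lt hz0im
  filter_upwards [this] with w hw
  rw [rs_plus_pos H hw, rs_plus_pos H1 hw]
  exact rsPhi_rec H H1 he (fun h => hw.ne' (Complex.arg_eq_zero_iff.1 h).2)

structure RsSeq (m : ℕ → ℝ) : Prop where
  one_le : ∀ N, 1 ≤ m N
  step : ∃ A : ℝ, 1 ≤ A ∧ ∀ N, m (N+1) ≤ A ^ (N+1) * m N

theorem rs_single {E : Type*} [NormedAddCommGroup E] [NormedSpace ℂ E] [CompleteSpace E]
    {m : ℕ → ℝ} (hm : RsSeq m) {R h : ℝ} (hR : 0 < R) (hh : 0 < h) (h1 : h ≤ 1) (f : ℂ → E)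
    (hf : DifferentiableOn ℂ f (rsS R h))
    (hb : ∃ C A : ℝ, 0 < C ∧ 0 < A ∧ ∀ N, ∀ z ∈ rsS R h, ‖f z‖ ≤ C * A ^ N * m N * ‖z‖ ^ N) :
    ∃ (P Q : ℂ → E) (b : ℕ → E),
      (∀ z : ℂ, z.arg ≠ 0 → DifferentiableAt ℂ P z) ∧
      DifferentiableOn ℂ Q (rsS R h) ∧
      (∀ z ∈ rsS R h, 0 < z.im → Q z = P z) ∧
      (∀ z ∈ rsS R h, z.im < 0 → Q z = P z + f z) ∧
      (∃ C A : ℝ, 0 < C ∧ 0 < A ∧ ∀ N, ∀ z : ℂ, h/2 ≤ |z.arg| →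
        ‖P z - ∑ n ∈ Finset.range N, z ^ n • b n‖ ≤ C * A ^ N * m N * ‖z‖ ^ N) ∧
      (∀ r < R, ∃ C A : ℝ, 0 < C ∧ 0 < A ∧ ∀ N, ∀ z : ℂ, z ≠ 0 → ‖z‖ < r → |z.arg| ≤ h/2 →
        ‖Q z - ∑ n ∈ Finset.range N, z ^ n • b n‖ ≤ C * A ^ N * m N * ‖z‖ ^ N) := by
  obtain ⟨C, A, hC, hA, hb⟩ := hb
  obtain ⟨hm1, A0, hA0, hm2⟩ := hm
  let g : ℕ → ℂ → E := fun N z => (z⁻¹)^N • f z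
  let B : ℕ → ℝ := fun N => (C * A * A0) * (A * A0) ^ N * m N
  have hA0p : 0 < A0 := by linarith
  have hBp : ∀ N, 0 ≤ B N := fun N => by
    have := hm1 N
    simp only [B]; positivity
  have Hg : ∀ N, RsHyp R h (B N) (g N) := by
    intro N
    refine ⟨hR, hh, h1, hBp N, ?_, ?_⟩
    · refine DifferentiableOn.smul ?_ hf
      exact DifferentiableOn.pow (differentiableOn_inv.mono fun z hz => hz.1) N
    · intro z hz
      have hz0 : 0 < ‖z‖ := norm_pos_iff.2 hz.1
      simp only [g]
      rw [norm_smul, norm_pow, norm_inv, inv_pow, inv_mul_le_iff₀ (by positivity)]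
      calc _ ≤ _ := hb (N+1) z hz
        _ ≤ C * A ^ (N+1) * (A0 ^ (N+1) * m N) * ‖z‖^(N+1) := by
          gcongr; exact hm2 N
        _ = _ := by simp only [B]; ring
  have hrec : ∀ N, ∀ z, g (N+1) z = z⁻¹ • g N z := by
    intro N z
    simp only [g]; rw [smul_smul, pow_succ']
  have hg0 : g 0 = f := by funext z; simp [g]
  let b : ℕ → E := fun n => rsB R (g n)
  have sumP : ∀ N, ∀ z : ℂ, z.arg ≠ 0 →
      rsPhi R f z = ∑ n ∈ Finset.range N, z ^ n • b n + z ^ N • rsPhi R (g N) z := by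
    intro N z hz
    induction N with
    | zero => simp [hg0]
    | succ N ih =>
      rw [ih, rsPhi_rec (Hg N) (Hg (N+1)) (hrec N) hz, Finset.sum_range_succ, smul_add, smul_smul,
        pow_succ, add_assoc]
  have sumQ : ∀ N, ∀ z ∈ rsS R h,
      rsPlus R f z = ∑ n ∈ Finset.range N, z ^ n • b n + z ^ N • rsPlus R (g N) z := by
    intro N z hz
    induction N with
    | zero => simp [hg0]
    | succ N ih =>
      rw [ih, rsPlus_rec (Hg N) (Hg (N+1)) (hrec N) hz, Finset.sum_range_succ, smul_add, smul_smul,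
        pow_succ, add_assoc]
  have H0 : RsHyp R h (B 0) f := hg0 ▸ Hg 0
  have fin : ∀ K : ℝ, 0 ≤ K → ∀ N (z : ℂ) (X Y W : E), X = Y + z ^ N • W → ‖W‖ ≤ K * B N →
      ‖X - Y‖ ≤ ((K + 1) * (C * A * A0)) * (A * A0) ^ N * m N * ‖z‖^N := by
    intro K hK N z X Y W h1 h2
    rw [h1, add_sub_cancel_left, norm_smul, norm_pow]
    calc _ ≤ ‖z‖^N * ((K+1) * B N) := by
          have := hBp N
          gcongr
          nlinarith
      _ = _ := by simp only [B]; ring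
  refine ⟨rsPhi R f, rsPlus R f, b, fun z hz => rsPhi_diff H0 hz, rsPlus_diff H0,
    fun z hz hi => rs_plus_pos H0 hi, fun z hz hi => rs_plus_neg H0 hi, ?_, ?_⟩
  · obtain ⟨K, hK, hKb⟩ := rsPhi_bound (h := h/2) R hR (by positivity) (by linarith)
    refine ⟨(K+1) * (C * A * A0), A * A0, by positivity, by positivity, fun N z hz => ?_⟩
    refine fin K hK N z _ _ _ (sumP N z ?_) (hKb _ _ _ (Hg N) z hz)
    intro h0
    rw [h0] at hz
    simp at hz; linarith
  · intro r hr
    obtain ⟨K, hK, hKb⟩ := rsPlus_bound (h' := 3*h/4) h1 hr hR (by linarith)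
    refine ⟨(K+1) * (C * A * A0), A * A0, by positivity, by positivity, fun N z hz1 hz2 hz3 => ?_⟩
    exact fin K hK N z _ _ _ (sumQ N z ⟨hz1, by linarith, by linarith⟩)
      (hKb _ _ (Hg N) z ⟨hz1, hz2, by linarith⟩)

theorem rs_unif {X : Type*} (U : Finset ℂ) (m : ℕ → ℝ) (hm : ∀ N, 1 ≤ m N) (S : ℂ → X → Prop)
    (T : ℂ → ℕ → X → ℝ) (nr : X → ℝ) (hn : ∀ x, 0 ≤ nr x)
    (H : ∀ u ∈ U, ∃ C A : ℝ, 0 < C ∧ 0 < A ∧ ∀ N, ∀ z, S u z → T u N z ≤ C * A ^ N * m N * nr z ^ N) :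
    ∃ C A : ℝ, 0 < C ∧ 0 < A ∧ ∀ u ∈ U, ∀ N, ∀ z, S u z → T u N z ≤ C * A ^ N * m N * nr z ^ N := by
  choose! C A hC hA hH using H
  have s1 : ∀ u ∈ U, C u ≤ ∑ v ∈ U, C v := fun u hu =>
    Finset.single_le_sum (fun v hv => (hC v hv).le) hu
  have s2 : ∀ u ∈ U, A u ≤ ∑ v ∈ U, A v := fun u hu =>
    Finset.single_le_sum (fun v hv => (hA v hv).le) hu
  have p1 : 0 ≤ ∑ v ∈ U, C v := Finset.sum_nonneg fun v hv => (hC v hv).le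
  have p2 : 0 ≤ ∑ v ∈ U, A v := Finset.sum_nonneg fun v hv => (hA v hv).le
  refine ⟨∑ v ∈ U, C v + 1, ∑ v ∈ U, A v + 1, by linarith, by linarith, ?_⟩
  intro u hu N z hz
  refine (hH u hu N z hz).trans ?_
  have := hm N
  have := hn z
  have := hC u hu
  have := hA u hu
  have := s1 u hu
  have := s2 u hu
  gcongr <;> linarith

/-- rays -/
theorem rs_rays (n : ℕ) (hn : 7 ≤ n) (h : ℝ) (hh : h = 2 * Real.pi / n) (ζ : ℂ)
    (hζ : ζ = Complex.exp (h * Complex.I)) :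
    ∃ U : Finset ℂ, (∀ u ∈ U, ‖u‖ = 1) ∧ (∀ u ∈ U, ζ⁻¹ * u ∈ U) ∧
      (∀ z : ℂ, z ≠ 0 → ∃ u ∈ U, 0 ≤ (z / u).arg ∧ (z/u).arg < h) ∧
      (∀ z : ℂ, z ≠ 0 → ∃ u ∈ U, |(z / u).arg| ≤ h / 2) ∧
      (∀ z : ℂ, z ≠ 0 → ∀ u ∈ U, ∀ v ∈ U, u ≠ v → h ≤ |(z / v).arg - (z / u).arg|) := by
  have hn0 : (0:ℝ) < n := by
    have : (7:ℝ) ≤ n := by exact_mod_cast hn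
    linarith
  have hpos : 0 < h := by rw [hh]; have := Real.pi_pos; positivity
  have hnh : (n:ℝ) * h = 2 * Real.pi := by rw [hh]; field_simp
  have hζn : ‖ζ‖ = 1 := by rw [hζ]; exact Complex.norm_exp_ofReal_mul_I h
  have hζ0 : ζ ≠ 0 := norm_pos_iff.1 (by rw [hζn]; norm_num)
  have hpow : ζ ^ n = 1 := by
    rw [hζ, ← Complex.exp_nat_mul, Complex.exp_eq_one_iff]
    refine ⟨1, ?_⟩
    have : ((n:ℝ) * h : ℂ) = 2 * Real.pi := by exact_mod_cast hnh
    rw [← mul_assoc]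
    push_cast at this ⊢
    rw [this]; ring
  have hzp : ∀ j : ℤ, ζ ^ j = Complex.exp ((j * h : ℝ) * Complex.I) := by
    intro j
    rw [hζ, ← Complex.exp_int_mul]; congr 1; push_cast; ring
  let U : Finset ℂ := (Finset.range n).image fun j => ζ ^ j
  have hU : ∀ u, u ∈ U ↔ ∃ j : ℤ, u = ζ ^ j := by
    intro u
    simp only [U, Finset.mem_image, Finset.mem_range]
    constructor
    · rintro ⟨j, _, rfl⟩; exact ⟨j, by simp⟩
    · rintro ⟨j, rfl⟩
      have hnz : (n:ℤ) ≠ 0 := by omega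
      refine ⟨(j % n).toNat, ?_, ?_⟩
      · have := Int.emod_lt_of_pos j (show (0:ℤ) < n by omega)
        have := Int.emod_nonneg j hnz
        omega
      · have h1 := Int.emod_nonneg j hnz
        rw [← zpow_natCast, Int.toNat_of_nonneg h1]
        conv_rhs => rw [← Int.emod_add_mul_ediv j n, zpow_add₀ hζ0, zpow_mul, zpow_natCast, hpow]
        simp
  have hUn : ∀ u ∈ U, ‖u‖ = 1 := by
    intro u hu
    obtain ⟨j, rfl⟩ := (hU u).1 hu
    rw [norm_zpow, hζn, one_zpow]
  have argz : ∀ z : ℂ, z ≠ 0 → ∀ j : ℤ, |z.arg - j * h| < Real.pi → (z / ζ ^ j).arg = z.arg - j * h := by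
    intro z hz j hj
    have : z / ζ ^ j = (‖z‖ : ℝ) * Complex.exp ((z.arg - j * h : ℝ) * Complex.I) := by
      conv_lhs => rw [← Complex.norm_mul_exp_arg_mul_I z]
      rw [hzp, mul_div_assoc, ← Complex.exp_sub]
      congr 2; push_cast; ring
    rw [this, Complex.exp_mul_I]
    apply Complex.arg_mul_cos_add_sin_mul_I (norm_pos_iff.2 hz)
    have := abs_lt.1 hj
    exact ⟨this.1, this.2.le⟩
  have hle1 : h ≤ 1 := by
    rw [hh, div_le_one hn0]
    have : (7:ℝ) ≤ n := by exact_mod_cast hn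
    linarith [Real.pi_lt_d2]
  refine ⟨U, hUn, ?_, ?_, ?_, ?_⟩
  · intro u hu
    obtain ⟨j, rfl⟩ := (hU u).1 hu
    refine (hU _).2 ⟨j - 1, ?_⟩
    rw [zpow_sub₀ hζ0, zpow_one]; field_simp
  · intro z hz
    have f1 := Int.floor_le (z.arg / h)
    have f2 := Int.lt_floor_add_one (z.arg / h)
    rw [le_div_iff₀ hpos] at f1
    rw [div_lt_iff₀ hpos] at f2
    have := argz z hz ⌊z.arg / h⌋ (by
      rw [abs_lt]; constructor <;> linarith [Real.pi_gt_three])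
    refine ⟨_, (hU _).2 ⟨⌊z.arg / h⌋, rfl⟩, ?_, ?_⟩
    · rw [this]; linarith
    · rw [this]; linarith
  · intro z hz
    have f1 := abs_sub_round (z.arg / h)
    have f3 : |z.arg - round (z.arg / h) * h| ≤ h / 2 := by
      have : z.arg - round (z.arg / h) * h = (z.arg / h - round (z.arg / h)) * h := by field_simp
      rw [this, abs_mul, abs_of_pos hpos]
      nlinarith
    have := argz z hz (round (z.arg / h)) (by linarith [Real.pi_gt_three])
    exact ⟨_, (hU _).2 ⟨round (z.arg / h), rfl⟩, by rw [this]; exact f3⟩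
  · intro z hz u hu v hv huv
    obtain ⟨j, hj⟩ := (hU u).1 hu
    obtain ⟨l, hl⟩ := (hU v).1 hv
    have hu0 : u ≠ 0 := norm_pos_iff.1 (by rw [hUn u hu]; norm_num)
    have hv0 : v ≠ 0 := norm_pos_iff.1 (by rw [hUn v hv]; norm_num)
    have e1 : z / u = (‖z‖ : ℝ) * Complex.exp ((z / u).arg * Complex.I) := by
      have := Complex.norm_mul_exp_arg_mul_I (z / u)
      rw [norm_div, hUn u hu, div_one] at this; exact this.symm
    have e2 : z / v = (‖z‖ : ℝ) * Complex.exp ((z / v).arg * Complex.I) := by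
      have := Complex.norm_mul_exp_arg_mul_I (z / v)
      rw [norm_div, hUn v hv, div_one] at this; exact this.symm
    have hnz : ((‖z‖ : ℝ) : ℂ) ≠ 0 := by exact_mod_cast (norm_pos_iff.2 hz).ne'
    have e3 : Complex.exp (((j - l : ℤ) * h : ℝ) * Complex.I) =
        Complex.exp (((z / v).arg - (z / u).arg : ℝ) * Complex.I) := by
      rw [← hzp, zpow_sub₀ hζ0, ← hj, ← hl]
      have : u / v = (z / v) / (z / u) := by field_simp
      rw [this, e1, e2, mul_div_mul_left _ _ hnz, ← Complex.exp_sub]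
      rw [← e1, ← e2]
      congr 1; push_cast; ring
    obtain ⟨k, hk⟩ := Complex.exp_eq_exp_iff_exists_int.1 e3
    have e4 : ((j - l : ℤ) * h : ℝ) = ((z / v).arg - (z / u).arg) + k * (2 * Real.pi) := by
      have := congrArg Complex.im hk
      simpa using this
    rw [← hnh] at e4
    have e5 : (z / v).arg - (z / u).arg = ((j - l - k * n : ℤ) : ℝ) * h := by
      push_cast at e4 ⊢; linarith
    rw [e5, abs_mul, abs_of_pos hpos]
    have : j - l - k * n ≠ 0 := by
      intro h0
      apply huv
      rw [h0] at e5
      simp only [Int.cast_zero, zero_mul, sub_eq_zero] at e5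
      have h7 : z / u = z / v := by rw [e1, e2, e5]
      field_simp at h7
      exact h7.symm
    have : (1:ℝ) ≤ |((j - l - k * n : ℤ) : ℝ)| := by
      rw [← Int.cast_abs]; exact_mod_cast Int.one_le_abs this
    nlinarith

theorem rs_nbr {ι : Type*} {R : ℝ} (hR : 0 < R) (V : ι → Set ℂ) (hVo : ∀ i, IsOpen (V i))
    (hVc : ∀ i, ∀ z ∈ V i, ∀ ρ : ℝ, 0 < ρ → ρ * ‖z‖ < R → (ρ : ℂ) * z ∈ V i)
    (hcov : ∀ z : ℂ, z ≠ 0 → ‖z‖ < R → ∃ i, z ∈ V i) :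
    ∃ δ > 0, ∀ u : ℂ, ‖u‖ = 1 → ∃ i, ∀ z : ℂ, z ≠ 0 → ‖z‖ < R → |(z / u).arg| < δ → z ∈ V i := by
  obtain ⟨δ, hδ, hL⟩ := lebesgue_number_lemma_of_metric (isCompact_sphere (0:ℂ) (R/2)) hVo (by
    intro z hz
    rw [mem_sphere_zero_iff_norm] at hz
    obtain ⟨i, hi⟩ := hcov z (norm_pos_iff.1 (by rw [hz]; positivity)) (by rw [hz]; linarith)
    exact Set.mem_iUnion.2 ⟨i, hi⟩)
  refine ⟨δ / R, by positivity, fun u hu => ?_⟩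
  obtain ⟨i, hi⟩ := hL ((R/2 : ℝ) * u) (by
    rw [mem_sphere_zero_iff_norm, norm_mul, hu, Complex.norm_real, Real.norm_eq_abs,
      abs_of_pos (by positivity), mul_one])
  refine ⟨i, fun z hz hzR harg => ?_⟩
  have hz0 : 0 < ‖z‖ := norm_pos_iff.2 hz
  have hu0 : u ≠ 0 := norm_pos_iff.1 (by rw [hu]; norm_num)
  have hnz : ((‖z‖ : ℝ) : ℂ) ≠ 0 := by exact_mod_cast hz0.ne'
  have e1 : z / u = (‖z‖ : ℝ) * Complex.exp ((z / u).arg * Complex.I) := by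
    have := Complex.norm_mul_exp_arg_mul_I (z / u)
    rw [norm_div, hu, div_one] at this; exact this.symm
  have e2 : z = (‖z‖ : ℝ) * (Complex.exp ((z / u).arg * Complex.I) * u) := by
    rw [← mul_assoc, ← e1]; field_simp
  have hmem : (R/2 : ℝ) * (Complex.exp ((z / u).arg * Complex.I) * u) ∈ V i := by
    apply hi
    rw [Metric.mem_ball, dist_eq_norm, ← mul_sub, norm_mul, Complex.norm_real, Real.norm_eq_abs,
      abs_of_pos (by positivity), ← sub_one_mul, norm_mul, hu, mul_one]
    have := Real.norm_exp_I_mul_ofReal_sub_one_le (x := (z / u).arg)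
    rw [mul_comm Complex.I] at this
    rw [Real.norm_eq_abs] at this
    have h3 : ‖Complex.exp ((z / u).arg * Complex.I) - 1‖ < δ / R := by linarith
    calc _ < R / 2 * (δ / R) := by gcongr
      _ = δ / 2 := by field_simp
      _ < δ := by linarith
  have := hVc i _ hmem (‖z‖ / (R/2)) (by positivity) (by
    rw [norm_mul, norm_mul, hu, Complex.norm_real, Real.norm_eq_abs,
      abs_of_pos (show 0 < R/2 by positivity), Complex.norm_exp_ofReal_mul_I]
    rw [mul_one, mul_one, div_mul_cancel₀ _ (by positivity)]; exact hzR)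
  rw [← mul_assoc, ← Complex.ofReal_mul, div_mul_cancel₀ _ (by positivity), ← e2] at this
  exact this

theorem rs_main {E : Type*} [NormedAddCommGroup E] [NormedSpace ℂ E] [CompleteSpace E]
    {m : ℕ → ℝ} (hm : RsSeq m) {ι : Type*} {R : ℝ} (hR : 0 < R) (V : ι → Set ℂ)
    (hVo : ∀ i, IsOpen (V i)) (hVs : ∀ i, ∀ z ∈ V i, z ≠ 0 ∧ ‖z‖ < R)
    (hVc : ∀ i, ∀ z ∈ V i, ∀ ρ : ℝ, 0 < ρ → ρ * ‖z‖ < R → (ρ : ℂ) * z ∈ V i)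
    (hcov : ∀ z : ℂ, z ≠ 0 → ‖z‖ < R → ∃ i, z ∈ V i)
    (D : ι → ι → ℂ → E) (hD : ∀ i j, DifferentiableOn ℂ (D i j) (V i ∩ V j))
    (hcoc : ∀ i j k, ∀ z, z ∈ V i → z ∈ V j → z ∈ V k → D i j z + D j k z = D i k z)
    (hb : ∀ i j, ∃ C A : ℝ, 0 < C ∧ 0 < A ∧ ∀ N, ∀ z ∈ V i ∩ V j,
      ‖D i j z‖ ≤ C * A ^ N * m N * ‖z‖ ^ N) :
    ∃ (g : ι → ℂ → E) (b : ℕ → E), (∀ i, DifferentiableOn ℂ (g i) (V i)) ∧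
      (∀ i j, ∀ z ∈ V i ∩ V j, g j z - g i z = D i j z) ∧
      ∀ i, ∀ r < R, ∃ C A : ℝ, 0 < C ∧ 0 < A ∧ ∀ N, ∀ z ∈ V i, ‖z‖ < r →
        ‖g i z - ∑ n ∈ Finset.range N, z ^ n • b n‖ ≤ C * A ^ N * m N * ‖z‖ ^ N := by
  classical
  obtain ⟨δ, hδ, hc⟩ := rs_nbr hR V hVo hVc hcov
  have : Nonempty ι := (hc 1 (by simp)).nonempty
  choose! c hc using hc
  obtain ⟨n0, hn0⟩ := exists_nat_gt (4 * Real.pi / δ)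
  obtain ⟨n, hn7, hnn⟩ : ∃ n : ℕ, 7 ≤ n ∧ n0 ≤ n := ⟨max 7 n0, le_max_left _ _, le_max_right _ _⟩
  have hn7' : (7:ℝ) ≤ n := by exact_mod_cast hn7
  have hnn' : (n0:ℝ) ≤ n := by exact_mod_cast hnn
  have hnp : (0:ℝ) < n := by linarith
  obtain ⟨h, hh⟩ : ∃ h : ℝ, h = 2 * Real.pi / n := ⟨_, rfl⟩
  have hpos : 0 < h := by rw [hh]; have := Real.pi_pos; positivity
  have hle1 : h ≤ 1 := by
    rw [hh, div_le_one hnp]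
    linarith [Real.pi_lt_d2]
  have h2δ : 2 * h ≤ δ := by
    rw [div_lt_iff₀ hδ] at hn0
    rw [hh, ← mul_div_assoc, div_le_iff₀ hnp]
    nlinarith
  obtain ⟨ζ, hζ⟩ : ∃ ζ : ℂ, ζ = Complex.exp (h * Complex.I) := ⟨_, rfl⟩
  obtain ⟨U, hU1, hUζ, hUs, hUr, hUd⟩ := rs_rays n hn7 h hh ζ hζ
  have hζn : ‖ζ‖ = 1 := by rw [hζ]; exact Complex.norm_exp_ofReal_mul_I h
  have hζ0 : ζ ≠ 0 := norm_pos_iff.1 (by rw [hζn]; norm_num)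
  have hζarg : ζ.arg = h := by
    rw [hζ, Complex.exp_mul_I]
    exact Complex.arg_cos_add_sin_mul_I ⟨by linarith [Real.pi_gt_three], by linarith [Real.pi_gt_three]⟩
  have hU0 : ∀ u ∈ U, u ≠ 0 := fun u hu => norm_pos_iff.1 (by rw [hU1 u hu]; norm_num)
  -- argument relative to the previous ray
  have hprev : ∀ u ∈ U, ∀ z : ℂ, z ≠ 0 → |(z / u).arg| < h →
      (z / (ζ⁻¹ * u)).arg = (z / u).arg + h := by
    intro u hu z hz ha
    have hu0 := hU0 u hu
    have : z / (ζ⁻¹ * u) = (z / u) * ζ := by field_simp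
    rw [this, Complex.arg_mul (div_ne_zero hz hu0) hζ0, hζarg]
    rw [hζarg]
    have := abs_lt.1 ha
    constructor <;> linarith [Real.pi_gt_three]
  have hcu : ∀ u ∈ U, ∀ z : ℂ, z ≠ 0 → ‖z‖ < R → |(z / u).arg| < 2 * h → z ∈ V (c u) :=
    fun u hu z hz hzR ha => hc u (hU1 u hu) z hz hzR (by linarith)
  have hcu' : ∀ u ∈ U, ∀ z : ℂ, z ≠ 0 → ‖z‖ < R → |(z / u).arg| < h → z ∈ V (c (ζ⁻¹ * u)) := by
    intro u hu z hz hzR ha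
    refine hcu _ (hUζ u hu) z hz hzR ?_
    rw [hprev u hu z hz ha]
    have := abs_lt.1 ha
    rw [abs_lt]; constructor <;> linarith
  have hS : ∀ u ∈ U, ∀ z : ℂ, z ≠ 0 → ‖z‖ < R → |(z / u).arg| < h → z / u ∈ rsS R h := by
    intro u hu z hz hzR ha
    refine ⟨div_ne_zero hz (hU0 u hu), ?_, ha⟩
    rw [norm_div, hU1 u hu, div_one]; exact hzR
  have hS' : ∀ u ∈ U, ∀ w ∈ rsS R h, w * u ∈ V (c (ζ⁻¹ * u)) ∩ V (c u) := by
    intro u hu w hw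
    have hu0 := hU0 u hu
    have e : w * u / u = w := by field_simp
    have hn : ‖w * u‖ < R := by rw [norm_mul, hU1 u hu, mul_one]; exact hw.2.1
    have ha : |(w * u / u).arg| < h := by rw [e]; exact hw.2.2
    exact ⟨hcu' u hu _ (mul_ne_zero hw.1 hu0) hn ha,
      hcu u hu _ (mul_ne_zero hw.1 hu0) hn (by linarith)⟩
  have hsing : ∀ u ∈ U, ∃ (P Q : ℂ → E) (b : ℕ → E),
      (∀ z : ℂ, z.arg ≠ 0 → DifferentiableAt ℂ P z) ∧
      DifferentiableOn ℂ Q (rsS R h) ∧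
      (∀ z ∈ rsS R h, 0 < z.im → Q z = P z) ∧
      (∀ z ∈ rsS R h, z.im < 0 → Q z = P z + D (c (ζ⁻¹ * u)) (c u) (z * u)) ∧
      (∃ C A : ℝ, 0 < C ∧ 0 < A ∧ ∀ N, ∀ z : ℂ, h/2 ≤ |z.arg| →
        ‖P z - ∑ n ∈ Finset.range N, z ^ n • b n‖ ≤ C * A ^ N * m N * ‖z‖ ^ N) ∧
      (∀ r < R, ∃ C A : ℝ, 0 < C ∧ 0 < A ∧ ∀ N, ∀ z : ℂ, z ≠ 0 → ‖z‖ < r → |z.arg| ≤ h/2 →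
        ‖Q z - ∑ n ∈ Finset.range N, z ^ n • b n‖ ≤ C * A ^ N * m N * ‖z‖ ^ N) := by
    intro u hu
    refine rs_single hm hR hpos hle1 (fun w => D (c (ζ⁻¹ * u)) (c u) (w * u)) ?_ ?_
    · exact (hD _ _).comp (differentiableOn_id.mul_const u) (hS' u hu)
    · obtain ⟨C, A, hC, hA, hCA⟩ := hb (c (ζ⁻¹ * u)) (c u)
      refine ⟨C, A, hC, hA, fun N z hz => ?_⟩
      have := hCA N (z * u) (hS' u hu z hz)
      rwa [norm_mul, hU1 u hu, mul_one] at this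
  choose! P Q bb hPd hQd hQP hQN hPb hQb using hsing
  choose! s hs1 hs2 hs3 using hUs
  let F : ℂ → ι → ℂ → E := fun u i z =>
    (∑ v ∈ U.erase u, P v (z / v)) + Q u (z / u) + D (c u) i z
  let g : ι → ℂ → E := fun i z => F (s z) i z
  have him : ∀ w : ℂ, |w.arg| < h → (0 < w.arg → 0 < w.im) ∧ (w.arg < 0 → w.im < 0) := by
    intro w hw
    refine ⟨fun h1 => ?_, fun h1 => Complex.arg_neg_iff.1 h1⟩
    have h2 := Complex.arg_nonneg_iff.1 h1.le
    rcases h2.lt_or_eq with h3 | h3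
    · exact h3
    · exfalso
      have := abs_lt.1 hw
      have h4 : w.arg < Real.pi := by linarith [Real.pi_gt_three]
      have h5 := Complex.arg_lt_pi_iff.1 h4
      rcases h5 with h5 | h5
      · have := Complex.arg_eq_zero_iff.2 ⟨h5, h3.symm⟩
        linarith
      · exact h5 h3.symm
  have key : ∀ i, ∀ z ∈ V i, ∀ u ∈ U, |(z / u).arg| < h → g i z = F u i z := by
    intro i z hzV u hu ha
    obtain ⟨hz, hzR⟩ := hVs i z hzV
    have hsU := hs1 z hz
    have hs2' := hs2 z hz
    have hs3' := hs3 z hz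
    have ha' := abs_lt.1 ha
    by_cases h0 : 0 ≤ (z / u).arg
    · have : s z = u := by
        by_contra hne
        have := hUd z hz _ hsU u hu hne
        have : |(z / u).arg - (z / s z).arg| < h := by
          rw [abs_lt]; constructor <;> linarith
        linarith
      simp only [g, this]
    · push Not at h0
      have hvU := hUζ u hu
      have hp := hprev u hu z hz ha
      have : s z = ζ⁻¹ * u := by
        by_contra hne
        have := hUd z hz _ hsU _ hvU hne
        have : |(z / (ζ⁻¹ * u)).arg - (z / s z).arg| < h := by
          rw [hp, abs_lt]; constructor <;> linarith
        linarith
      simp only [g, this]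
      have hne : ζ⁻¹ * u ≠ u := by
        intro he
        rw [he] at hp
        linarith
      obtain ⟨v, hv⟩ : ∃ v, v = ζ⁻¹ * u := ⟨_, rfl⟩
      have hva : |(z / v).arg| < h := by rw [hv, hp, abs_lt]; constructor <;> linarith
      have q1 : Q v (z / v) = P v (z / v) := by
        refine hQP v (hv ▸ hvU) _ (hS v (hv ▸ hvU) z hz hzR hva) ((him _ hva).1 ?_)
        rw [hv, hp]; linarith
      have q2 : Q u (z / u) = P u (z / u) + D (c v) (c u) z := by
        have := hQN u hu _ (hS u hu z hz hzR ha) ((him _ ha).2 h0)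
        rw [div_mul_cancel₀ _ (hU0 u hu)] at this
        rw [hv]; exact this
      have q3 := hcoc (c v) (c u) i z (by rw [hv]; exact hcu' u hu z hz hzR ha)
        (hcu u hu z hz hzR (by linarith)) hzV
      have q4 : (∑ w ∈ U.erase v, P w (z / w)) + P v (z / v) = ∑ w ∈ U, P w (z / w) :=
        Finset.sum_erase_add _ _ (hv ▸ hvU)
      have q5 : (∑ w ∈ U.erase u, P w (z / w)) + P u (z / u) = ∑ w ∈ U, P w (z / w) :=
        Finset.sum_erase_add _ _ hu
      rw [← hv]
      simp only [F]
      rw [q1, q4, q2, ← add_assoc, q5, add_assoc, q3]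
  refine ⟨g, fun n => ∑ u ∈ U, (u⁻¹) ^ n • bb u n, ?_, ?_, ?_⟩
  · intro i z0 hz0
    obtain ⟨hz, hzR⟩ := hVs i z0 hz0
    obtain ⟨u, hu, hua⟩ : ∃ u ∈ U, |(z0 / u).arg| < h := by
      obtain ⟨u, hu, h2⟩ := hUr z0 hz
      exact ⟨u, hu, by linarith⟩
    have hzS := hS u hu z0 hz hzR hua
    have hcontS : ∀ᶠ z in nhds z0, z / u ∈ rsS R h := by
      have : ContinuousAt (fun z : ℂ => z / u) z0 := by fun_prop
      exact this.eventually ((rsS_open hle1).mem_nhds hzS)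
    have hev : g i =ᶠ[nhds z0] F u i := by
      filter_upwards [hcontS, (hVo i).mem_nhds hz0] with z h1 h2
      exact key i z h2 u hu h1.2.2
    apply DifferentiableAt.differentiableWithinAt
    refine DifferentiableAt.congr_of_eventuallyEq ?_ hev
    refine DifferentiableAt.add (DifferentiableAt.add ?_ ?_) ?_
    · refine DifferentiableAt.fun_sum fun v hv => ?_
      obtain ⟨hvu, hvU⟩ := Finset.mem_erase.1 hv
      have hd : DifferentiableAt ℂ (P v) (z0 / v) := by
        apply hPd v hvU
        intro h0
        have := hUd z0 hz v hvU u hu hvu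
        rw [h0, sub_zero] at this
        linarith
      exact hd.comp z0 (f := fun z : ℂ => z / v) (by fun_prop)
    · have hd : DifferentiableAt ℂ (Q u) (z0 / u) :=
        (hQd u hu).differentiableAt ((rsS_open hle1).mem_nhds hzS)
      exact hd.comp z0 (f := fun z : ℂ => z / u) (by fun_prop)
    · refine (hD (c u) i).differentiableAt ?_
      exact ((hVo _).inter (hVo i)).mem_nhds ⟨hcu u hu z0 hz hzR (by linarith), hz0⟩
  · intro i j z hz
    obtain ⟨hz0, hzR⟩ := hVs i z hz.1
    have hsU := hs1 z hz0
    have hs2' := hs2 z hz0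
    have hs3' := hs3 z hz0
    have hzc : z ∈ V (c (s z)) := hcu _ hsU z hz0 hzR (by rw [abs_of_nonneg hs2']; linarith)
    have := hcoc (c (s z)) i j z hzc hz.1 hz.2
    simp only [g, F]
    rw [← this]
    abel
  · intro i r hr
    obtain ⟨C1, A1, hC1, hA1, hB1⟩ := rs_unif U m hm.one_le (fun u (z:ℂ) => h/2 ≤ |z.arg|)
      (fun u N z => ‖P u z - ∑ n ∈ Finset.range N, z ^ n • bb u n‖) (fun z => ‖z‖) (fun z => norm_nonneg z)
      (fun u hu => hPb u hu)
    obtain ⟨C2, A2, hC2, hA2, hB2⟩ := rs_unif U m hm.one_le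
      (fun u (z:ℂ) => z ≠ 0 ∧ ‖z‖ < r ∧ |z.arg| ≤ h/2)
      (fun u N z => ‖Q u z - ∑ n ∈ Finset.range N, z ^ n • bb u n‖) (fun z => ‖z‖) (fun z => norm_nonneg z)
      (fun u hu => by
        obtain ⟨C, A, hC, hA, H⟩ := hQb u hu r hr
        exact ⟨C, A, hC, hA, fun N z hz => H N z hz.1 hz.2.1 hz.2.2⟩)
    obtain ⟨C3, A3, hC3, hA3, hB3⟩ := rs_unif U m hm.one_le
      (fun u (z:ℂ) => z ∈ V (c u) ∩ V i)
      (fun u N z => ‖D (c u) i z‖) (fun z => ‖z‖) (fun z => norm_nonneg z)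
      (fun u hu => hb (c u) i)
    refine ⟨U.card * C1 + C2 + C3, A1 + A2 + A3, by positivity, by positivity, ?_⟩
    intro N z hzV hzr
    obtain ⟨hz, hzR⟩ := hVs i z hzV
    obtain ⟨u, hu, hua⟩ := hUr z hz
    rw [key i z hzV u hu (by linarith)]
    have hnd : ∀ v ∈ U, ‖z / v‖ = ‖z‖ := fun v hv => by rw [norm_div, hU1 v hv, div_one]
    have hsum : ∑ n ∈ Finset.range N, z ^ n • ∑ v ∈ U, (v⁻¹) ^ n • bb v n
        = ∑ v ∈ U, ∑ n ∈ Finset.range N, (z / v) ^ n • bb v n := by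
      rw [Finset.sum_comm]
      refine Finset.sum_congr rfl fun n _ => ?_
      rw [Finset.smul_sum]
      refine Finset.sum_congr rfl fun v _ => ?_
      rw [smul_smul, ← mul_pow, div_eq_mul_inv]
    have hdec : F u i z - ∑ n ∈ Finset.range N, z ^ n • ∑ v ∈ U, (v⁻¹) ^ n • bb v n
        = (∑ v ∈ U.erase u, (P v (z / v) - ∑ n ∈ Finset.range N, (z / v) ^ n • bb v n))
          + (Q u (z / u) - ∑ n ∈ Finset.range N, (z / u) ^ n • bb u n) + D (c u) i z := by
      rw [hsum, ← Finset.sum_erase_add _ _ hu, Finset.sum_sub_distrib]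
      simp only [F]
      abel
    rw [hdec]
    have hmN := hm.one_le N
    set W := (A1 + A2 + A3) ^ N * m N * ‖z‖ ^ N with hW
    have hW0 : 0 ≤ W := by positivity
    have t1 : ∀ v ∈ U.erase u, ‖P v (z / v) - ∑ n ∈ Finset.range N, (z / v) ^ n • bb v n‖ ≤ C1 * W := by
      intro v hv
      obtain ⟨hvu, hvU⟩ := Finset.mem_erase.1 hv
      have h2 : h / 2 ≤ |(z / v).arg| := by
        have := hUd z hz u hu v hvU (Ne.symm hvu)
        have := abs_sub (z / v).arg (z / u).arg
        linarith
      have := hB1 v hvU N (z / v) h2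
      rw [hnd v hvU] at this
      refine this.trans ?_
      rw [hW, mul_assoc, mul_assoc, mul_assoc]
      gcongr
      linarith
    have t2 : ‖Q u (z / u) - ∑ n ∈ Finset.range N, (z / u) ^ n • bb u n‖ ≤ C2 * W := by
      have := hB2 u hu N (z / u) ⟨div_ne_zero hz (hU0 u hu), by rw [hnd u hu]; exact hzr, hua⟩
      rw [hnd u hu] at this
      refine this.trans ?_
      rw [hW, mul_assoc, mul_assoc, mul_assoc]
      gcongr
      linarith
    have t3 : ‖D (c u) i z‖ ≤ C3 * W := by
      have := hB3 u hu N z ⟨hcu u hu z hz hzR (by linarith), hzV⟩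
      refine this.trans ?_
      rw [hW, mul_assoc, mul_assoc, mul_assoc]
      gcongr
      linarith
    have t4 : ‖∑ v ∈ U.erase u, (P v (z / v) - ∑ n ∈ Finset.range N, (z / v) ^ n • bb v n)‖
        ≤ U.card * (C1 * W) := by
      refine (norm_sum_le_of_le _ t1).trans ?_
      rw [Finset.sum_const, nsmul_eq_mul]
      have : ((U.erase u).card : ℝ) ≤ U.card := by
        exact_mod_cast Finset.card_le_card (Finset.erase_subset _ _)
      gcongr
    calc _ ≤ U.card * (C1 * W) + C2 * W + C3 * W :=
          (norm_add_le _ _).trans (add_le_add ((norm_add_le _ _).trans (add_le_add t4 t2)) t3)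
      _ = _ := by rw [hW]; ring

theorem rs_sector_eq (θ1 θ2 r : ℝ) (hr : 0 < r) : planarSector θ1 θ2 r
    = Complex.exp '' {w : ℂ | w.re < Real.log r ∧ θ1 < w.im ∧ w.im < θ2} := by
  ext z
  constructor
  · rintro ⟨ρ, θ, h0, h1, h2, h3, rfl⟩
    refine ⟨(Real.log ρ : ℝ) + (θ : ℝ) * Complex.I, ⟨?_, ?_, ?_⟩, ?_⟩
    · simpa using Real.log_lt_log h0 h1
    · simpa using h2
    · simpa using h3
    · rw [Complex.exp_add, ← Complex.ofReal_exp, Real.exp_log h0]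
  · rintro ⟨w, ⟨h1, h2, h3⟩, rfl⟩
    refine ⟨Real.exp w.re, w.im, Real.exp_pos _, ?_, h2, h3, ?_⟩
    · rw [← Real.lt_log_iff_exp_lt hr]; exact h1
    · rw [Complex.ofReal_exp, ← Complex.exp_add, Complex.re_add_im]

theorem rs_sector_open (θ1 θ2 r : ℝ) (hr : 0 < r) : IsOpen (planarSector θ1 θ2 r) := by
  rw [rs_sector_eq θ1 θ2 r hr]
  apply Complex.isOpenMap_exp
  refine (isOpen_lt Complex.continuous_re continuous_const).inter
    ((isOpen_lt continuous_const Complex.continuous_im).inter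
      (isOpen_lt Complex.continuous_im continuous_const))

theorem rs_sector_norm {θ1 θ2 r : ℝ} {z : ℂ} (hz : z ∈ planarSector θ1 θ2 r) :
    z ≠ 0 ∧ ‖z‖ < r := by
  obtain ⟨ρ, θ, h0, h1, h2, h3, rfl⟩ := hz
  have : ‖(ρ : ℂ) * Complex.exp ((θ : ℂ) * Complex.I)‖ = ρ := by
    rw [norm_mul, Complex.norm_exp_ofReal_mul_I, Complex.norm_real, Real.norm_eq_abs,
      abs_of_pos h0, mul_one]
  exact ⟨norm_pos_iff.1 (by rw [this]; exact h0), by rw [this]; exact h1⟩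

theorem rs_sector_conic {θ1 θ2 r : ℝ} {z : ℂ} (hz : z ∈ planarSector θ1 θ2 r) (t : ℝ)
    (ht : 0 < t) (htz : t * ‖z‖ < r) : (t : ℂ) * z ∈ planarSector θ1 θ2 r := by
  obtain ⟨ρ, θ, h0, h1, h2, h3, rfl⟩ := hz
  have : ‖(ρ : ℂ) * Complex.exp ((θ : ℂ) * Complex.I)‖ = ρ := by
    rw [norm_mul, Complex.norm_exp_ofReal_mul_I, Complex.norm_real, Real.norm_eq_abs,
      abs_of_pos h0, mul_one]
  rw [this] at htz
  exact ⟨t * ρ, θ, by positivity, htz, h2, h3, by push_cast; ring⟩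

theorem rs_subsector {θ1 θ2 r R : ℝ} {V : Set ℂ} (hV : ∀ z ∈ V, ‖z‖ < R)
    (hcl : closure (planarSector θ1 θ2 r) ⊆ V ∪ {0}) {z : ℂ} (hz : z ∈ planarSector θ1 θ2 r) :
    r < R := by
  obtain ⟨ρ, θ, h0, h1, h2, h3, rfl⟩ := hz
  have hr : 0 < r := h0.trans h1
  have hmem : (r : ℂ) * Complex.exp ((θ : ℂ) * Complex.I) ∈ closure (planarSector θ1 θ2 r) := by
    have hc : Continuous fun t : ℝ => (t : ℂ) * Complex.exp ((θ : ℂ) * Complex.I) := by fun_prop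
    have h4 : r ∈ closure (Set.Ioo 0 r) := by
      rw [closure_Ioo hr.ne]; exact ⟨hr.le, le_rfl⟩
    have := image_closure_subset_closure_image hc (Set.mem_image_of_mem _ h4)
    refine closure_mono ?_ this
    rintro _ ⟨t, ht, rfl⟩
    exact ⟨t, θ, ht.1, ht.2, h2, h3, rfl⟩
  have hn : ‖(r : ℂ) * Complex.exp ((θ : ℂ) * Complex.I)‖ = r := by
    rw [norm_mul, Complex.norm_exp_ofReal_mul_I, Complex.norm_real, Real.norm_eq_abs,
      abs_of_pos hr, mul_one]
  rcases hcl hmem with h | h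
  · rw [← hn]; exact hV _ h
  · have : ‖(r : ℂ) * Complex.exp ((θ : ℂ) * Complex.I)‖ = 0 := by rw [h]; simp
    linarith

theorem rs_seq_gevrey (k : ℕ) (hk : 1 ≤ k) :
    RsSeq (fun N => (N.factorial : ℝ) ^ (1 / (k : ℝ))) := by
  have hk' : (1:ℝ) ≤ k := by exact_mod_cast hk
  constructor
  · intro N
    exact Real.one_le_rpow (by exact_mod_cast Nat.one_le_iff_ne_zero.2 (Nat.factorial_ne_zero N))
      (by positivity)
  · refine ⟨2, by norm_num, fun N => ?_⟩
    simp only [Nat.factorial_succ]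
    push_cast
    rw [Real.mul_rpow (by positivity) (by positivity)]
    gcongr
    calc ((N:ℝ) + 1) ^ (1 / (k:ℝ)) ≤ ((N:ℝ)+1) ^ (1:ℝ) := by
          apply Real.rpow_le_rpow_of_exponent_le
          · linarith [Nat.cast_nonneg (α := ℝ) N]
          · rw [div_le_one (by linarith)]; exact hk'
      _ = ((N + 1 : ℕ) : ℝ) := by rw [Real.rpow_one]; push_cast; rfl
      _ ≤ 2 ^ (N+1) := by exact_mod_cast (Nat.lt_two_pow_self (n := N+1)).le

theorem rs_seq_q (q : ℝ) (hq : 1 < q) (κ : ℝ) (hκ : 0 < κ) :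
    RsSeq (fun N => q ^ ((N : ℝ) ^ 2 / (2 * κ))) := by
  have hq0 : 0 < q := by linarith
  constructor
  · intro N
    exact Real.one_le_rpow hq.le (by positivity)
  · refine ⟨q ^ (1 / κ), Real.one_le_rpow hq.le (by positivity), fun N => ?_⟩
    rw [← Real.rpow_natCast (q ^ _), ← Real.rpow_mul hq0.le, ← Real.rpow_add hq0]
    apply Real.rpow_le_rpow_of_exponent_le hq.le
    have : (1 / κ * ((N + 1 : ℕ) : ℝ) + (N : ℝ) ^ 2 / (2 * κ)) - ((N + 1 : ℕ) : ℝ) ^ 2 / (2 * κ)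
       = 1 / (2 * κ) := by push_cast; field_simp; ring
    have h2 : 0 < 1 / (2 * κ) := by positivity
    linarith

theorem rs_flat_gevrey (k : ℕ) (hk : 1 ≤ k) (M : ℝ) (hM : 0 < M) (N : ℕ) (ρ : ℝ) (hρ : 0 < ρ) :
    Real.exp (-M / ρ ^ k) ≤ (M ^ (-(1 / (k:ℝ)))) ^ N * (N.factorial : ℝ) ^ (1 / (k : ℝ)) * ρ ^ N := by
  have hk' : (1:ℝ) ≤ k := by exact_mod_cast hk
  have hk0 : (0:ℝ) < k := by linarith
  have hx : 0 < M / ρ ^ k := by positivity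
  have h1 : Real.exp (-(M / ρ ^ k) * k) ≤ N.factorial * (ρ ^ k / M) ^ N := by
    have h2 := Real.pow_div_factorial_le_exp (M / ρ ^ k) hx.le N
    have h3 : Real.exp (-(M / ρ ^ k) * k) ≤ Real.exp (-(M / ρ ^ k)) := by
      apply Real.exp_le_exp.2; nlinarith
    refine h3.trans ?_
    rw [Real.exp_neg, inv_le_comm₀ (Real.exp_pos _) (by positivity)]
    refine le_trans (le_of_eq ?_) h2
    rw [mul_inv, ← inv_pow, inv_div]; ring
  have h4 := Real.rpow_le_rpow (Real.exp_pos _).le h1 (show (0:ℝ) ≤ 1 / k by positivity)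
  rw [← Real.exp_mul] at h4
  have e1 : -(M / ρ ^ k) * k * (1 / (k:ℝ)) = -M / ρ ^ k := by field_simp
  rw [e1] at h4
  refine h4.trans (le_of_eq ?_)
  rw [Real.mul_rpow (by positivity) (by positivity)]
  have e2 : ((ρ ^ k / M) ^ N) ^ (1 / (k:ℝ)) = (M ^ (-(1 / (k:ℝ)))) ^ N * ρ ^ N := by
    rw [← Real.rpow_natCast, ← Real.rpow_mul (by positivity), mul_comm, Real.rpow_mul (by positivity),
      Real.rpow_natCast, ← mul_pow, Real.div_rpow (by positivity) hM.le, Real.rpow_neg hM.le,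
      one_div, Real.pow_rpow_inv_natCast hρ.le (by omega), div_eq_mul_inv, mul_comm]
  rw [e2]; ring

theorem rs_flat_q (q : ℝ) (hq : 1 < q) (κ : ℝ) (hκ : 0 < κ) (M : ℝ) : ∃ C A : ℝ, 0 < C ∧ 0 < A ∧
    ∀ (N : ℕ) (ρ : ℝ), 0 < ρ →
    ρ ^ M * Real.exp (-(κ / (2 * Real.log q)) * (Real.log ρ) ^ 2)
      ≤ C * A ^ N * q ^ ((N : ℝ) ^ 2 / (2 * κ)) * ρ ^ N := by
  have hl : 0 < Real.log q := Real.log_pos hq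
  have hq0 : 0 < q := by linarith
  refine ⟨Real.exp (M ^ 2 * Real.log q / (2 * κ)), Real.exp (-(M * Real.log q / κ)), Real.exp_pos _,
    Real.exp_pos _, fun N ρ hρ => ?_⟩
  obtain ⟨x, rfl⟩ : ∃ x, ρ = Real.exp x := ⟨Real.log ρ, (Real.exp_log hρ).symm⟩
  rw [Real.log_exp, ← Real.exp_mul, ← Real.exp_add, Real.rpow_def_of_pos hq0, ← Real.exp_nat_mul,
    ← Real.exp_nat_mul, ← Real.exp_add, ← Real.exp_add, ← Real.exp_add, Real.exp_le_exp]
  generalize Real.log q = l at *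
  have : (M ^ 2 * l / (2 * κ) + N * -(M * l / κ) + l * ((N:ℝ) ^ 2 / (2 * κ)) + N * x)
      - (x * M + -(κ / (2 * l)) * x ^ 2) = κ / (2 * l) * (x - (M - N) * l / κ) ^ 2 := by
    field_simp; ring
  have h2 : 0 ≤ κ / (2 * l) * (x - (M - N) * l / κ) ^ 2 := by positivity
  linarith

theorem stmt_18 {E : Type*} [NormedAddCommGroup E] [NormedSpace ℂ E] [CompleteSpace E]
    (q : ℝ) (hq : 1 < q) (k : ℕ) (hk : 1 ≤ k) (κ : ℝ) (hκ : 0 < κ)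
    (ς : ℕ) (hς : 2 ≤ ς) (χ : ℕ → ℕ) (hχ : ∀ p < ς, 1 ≤ χ p)
    (eps0 : ℝ) (heps0 : 0 < eps0)
    (Esec : ℕ → ℕ → Set ℂ) (hE : IsGoodCovering2 ς χ eps0 Esec)
    (G : ℕ → ℕ → ℂ → E)
    (hol : ∀ p < ς, ∀ p' < χ p, DifferentiableOn ℂ (G p p') (Esec p p'))
    (bdd : ∀ p < ς, ∀ p' < χ p, ∃ M : ℝ, ∀ eps ∈ Esec p p', ‖G p p' eps‖ ≤ M)
    (flat1 : ∀ p < ς, ∀ p1 < χ p, ∀ p2 < χ p, p1 ≠ p2 →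
      (Esec p p1 ∩ Esec p p2).Nonempty →
      ∃ K1 M1 : ℝ, 0 < K1 ∧ 0 < M1 ∧
        ∀ eps ∈ Esec p p1 ∩ Esec p p2,
          ‖G p p2 eps - G p p1 eps‖ ≤ K1 * Real.exp (-M1 / ‖eps‖ ^ k))
    (flat2 : ∀ p < ς, ∀ p' < ς, p ≠ p' → ∀ p1 < χ p, ∀ p2 < χ p',
      (Esec p p1 ∩ Esec p' p2).Nonempty →
      ∃ K2 : ℝ, ∃ M2 : ℝ, 0 < K2 ∧
        ∀ eps ∈ Esec p p1 ∩ Esec p' p2,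
          ‖G p' p2 eps - G p p1 eps‖
            ≤ K2 * ‖eps‖ ^ M2 *
              Real.exp (-(κ / (2 * Real.log q)) * (Real.log ‖eps‖) ^ 2)) :
    ∃ (acoef : ℕ → E) (ra : ℝ) (a : ℂ → E), 0 < ra ∧
      (∀ eps ∈ Metric.ball (0 : ℂ) ra, HasSum (fun n => eps ^ n • acoef n) (a eps)) ∧
      ∃ G1hat G2hat : ℕ → E,
        ∀ p < ς, ∀ p1 < χ p,
          ∃ G1 G2 : ℂ → E,
            (∀ eps ∈ Esec p p1, G p p1 eps = a eps + G1 eps + G2 eps) ∧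
            DifferentiableOn ℂ G1 (Esec p p1) ∧
            gevreyAsymp (k : ℝ) (Esec p p1) G1 G1hat ∧
            DifferentiableOn ℂ G2 (Esec p p1) ∧
            qAsymp q κ (Esec p p1) G2 G2hat := by
  classical
  obtain ⟨hsec, -, htri, hun⟩ := hE
  let ι := {x : ℕ × ℕ // x.1 < ς ∧ x.2 < χ x.1}
  let V : ι → Set ℂ := fun i => Esec i.1.1 i.1.2
  let GG : ι → ℂ → E := fun i => G i.1.1 i.1.2
  have hVo : ∀ i, IsOpen (V i) := by
    intro i
    obtain ⟨θ1, θ2, -, -, h⟩ := hsec i.1.1 i.2.1 i.1.2 i.2.2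
    simp only [V, h]
    exact rs_sector_open _ _ _ heps0
  have hVs : ∀ i, ∀ z ∈ V i, z ≠ 0 ∧ ‖z‖ < eps0 := by
    intro i z hz
    obtain ⟨θ1, θ2, -, -, h⟩ := hsec i.1.1 i.2.1 i.1.2 i.2.2
    simp only [V, h] at hz
    exact rs_sector_norm hz
  have hVc : ∀ i, ∀ z ∈ V i, ∀ ρ : ℝ, 0 < ρ → ρ * ‖z‖ < eps0 → (ρ : ℂ) * z ∈ V i := by
    intro i z hz ρ h1 h2
    obtain ⟨θ1, θ2, -, -, h⟩ := hsec i.1.1 i.2.1 i.1.2 i.2.2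
    simp only [V, h] at hz ⊢
    exact rs_sector_conic hz ρ h1 h2
  have hcov : ∀ z : ℂ, z ≠ 0 → ‖z‖ < eps0 → ∃ i, z ∈ V i := by
    intro z hz hzR
    have : z ∈ Metric.ball (0 : ℂ) eps0 \ {0} := ⟨by simpa using hzR, by simpa using hz⟩
    rw [← hun] at this
    simp only [Set.mem_iUnion, Finset.mem_range] at this
    obtain ⟨p, hp, p', hp', h⟩ := this
    exact ⟨⟨(p, p'), hp, hp'⟩, h⟩
  have hGd : ∀ i, DifferentiableOn ℂ (GG i) (V i) := fun i => hol i.1.1 i.2.1 i.1.2 i.2.2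
  have htr : ∀ i j l : ι, ∀ z, z ∈ V i → z ∈ V j → z ∈ V l → i = j ∨ i = l ∨ j = l := by
    intro i j l z hi hj hl
    by_contra hne
    push Not at hne
    have := htri i.1.1 i.2.1 i.1.2 i.2.2 j.1.1 j.2.1 j.1.2 j.2.2 l.1.1 l.2.1 l.1.2 l.2.2
      (fun h => hne.1 (Subtype.ext h)) (fun h => hne.2.1 (Subtype.ext h))
      (fun h => hne.2.2 (Subtype.ext h))
    have hm : z ∈ Esec i.1.1 i.1.2 ∩ Esec j.1.1 j.1.2 ∩ Esec l.1.1 l.1.2 := ⟨⟨hi, hj⟩, hl⟩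
    rw [this] at hm
    exact hm
  let D1 : ι → ι → ℂ → E := fun i j z => if i.1.1 = j.1.1 then GG j z - GG i z else 0
  let D2 : ι → ι → ℂ → E := fun i j z => if i.1.1 = j.1.1 then 0 else GG j z - GG i z
  have hdiff : ∀ i j, DifferentiableOn ℂ (fun z => GG j z - GG i z) (V i ∩ V j) := fun i j =>
    ((hGd j).mono Set.inter_subset_right).sub ((hGd i).mono Set.inter_subset_left)
  have hD1 : ∀ i j, DifferentiableOn ℂ (D1 i j) (V i ∩ V j) := by
    intro i j
    by_cases h : i.1.1 = j.1.1
    · simpa only [D1, h, if_true] using hdiff i j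
    · simp only [D1, h, if_false]; exact differentiableOn_const _
  have hD2 : ∀ i j, DifferentiableOn ℂ (D2 i j) (V i ∩ V j) := by
    intro i j
    by_cases h : i.1.1 = j.1.1
    · simp only [D2, h, if_true]; exact differentiableOn_const _
    · simpa only [D2, h, if_false] using hdiff i j
  have hcoc1 : ∀ i j l, ∀ z, z ∈ V i → z ∈ V j → z ∈ V l → D1 i j z + D1 j l z = D1 i l z := by
    intro i j l z hi hj hl
    rcases htr i j l z hi hj hl with rfl | rfl | rfl
    · simp [D1]
    · by_cases h : i.1.1 = j.1.1
      · simp [D1, h]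
      · simp [D1, h, Ne.symm h]
    · simp [D1]
  have hcoc2 : ∀ i j l, ∀ z, z ∈ V i → z ∈ V j → z ∈ V l → D2 i j z + D2 j l z = D2 i l z := by
    intro i j l z hi hj hl
    rcases htr i j l z hi hj hl with rfl | rfl | rfl
    · simp [D2]
    · by_cases h : i.1.1 = j.1.1
      · simp [D2, h]
      · simp [D2, h, Ne.symm h]
    · simp [D2]
  have hm1 := rs_seq_gevrey k hk
  have hm2 := rs_seq_q q hq κ hκ
  have hq0 : 0 < q := by linarith
  have hb1 : ∀ i j, ∃ C A : ℝ, 0 < C ∧ 0 < A ∧ ∀ N : ℕ, ∀ z ∈ V i ∩ V j,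
      ‖D1 i j z‖ ≤ C * A ^ N * (N.factorial : ℝ) ^ (1 / (k : ℝ)) * ‖z‖ ^ N := by
    intro i j
    have triv : (∀ z ∈ V i ∩ V j, D1 i j z = 0) → ∃ C A : ℝ, 0 < C ∧ 0 < A ∧
        ∀ N : ℕ, ∀ z ∈ V i ∩ V j,
        ‖D1 i j z‖ ≤ C * A ^ N * (N.factorial : ℝ) ^ (1 / (k : ℝ)) * ‖z‖ ^ N := by
      intro h
      refine ⟨1, 1, one_pos, one_pos, fun N z hz => ?_⟩
      rw [h z hz, norm_zero]; positivity
    by_cases h : i.1.1 = j.1.1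
    · by_cases h2 : i = j
      · subst h2; exact triv (fun z _ => by simp [D1])
      by_cases hne : (V i ∩ V j).Nonempty
      · obtain ⟨⟨p, p1⟩, hi⟩ := i
        obtain ⟨⟨p', p2⟩, hj⟩ := j
        simp only at h
        subst h
        have h3 : p1 ≠ p2 := fun h => h2 (by subst h; rfl)
        obtain ⟨K, M, hK, hM, hf⟩ := flat1 p hi.1 p1 hi.2 p2 hj.2 h3 hne
        refine ⟨K, M ^ (-(1 / (k:ℝ))), hK, by positivity, fun N z hz => ?_⟩
        have hz0 : 0 < ‖z‖ := norm_pos_iff.2 (hVs _ z hz.1).1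
        have h5 := hf z hz
        have h6 := mul_le_mul_of_nonneg_left (rs_flat_gevrey k hk M hM N ‖z‖ hz0) hK.le
        simp only [D1, GG, if_true]
        refine h5.trans (h6.trans (le_of_eq ?_))
        ring
      · exact triv (fun z hz => absurd ⟨z, hz⟩ hne)
    · exact triv (fun z _ => by simp [D1, h])
  have hb2 : ∀ i j, ∃ C A : ℝ, 0 < C ∧ 0 < A ∧ ∀ N : ℕ, ∀ z ∈ V i ∩ V j,
      ‖D2 i j z‖ ≤ C * A ^ N * q ^ ((N : ℝ) ^ 2 / (2 * κ)) * ‖z‖ ^ N := by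
    intro i j
    have triv : (∀ z ∈ V i ∩ V j, D2 i j z = 0) → ∃ C A : ℝ, 0 < C ∧ 0 < A ∧
        ∀ N : ℕ, ∀ z ∈ V i ∩ V j,
        ‖D2 i j z‖ ≤ C * A ^ N * q ^ ((N : ℝ) ^ 2 / (2 * κ)) * ‖z‖ ^ N := by
      intro h
      refine ⟨1, 1, one_pos, one_pos, fun N z hz => ?_⟩
      rw [h z hz, norm_zero]; positivity
    by_cases h : i.1.1 = j.1.1
    · exact triv (fun z _ => by simp [D2, h])
    · by_cases hne : (V i ∩ V j).Nonempty
      · obtain ⟨K, M, hK, hf⟩ := flat2 i.1.1 i.2.1 j.1.1 j.2.1 h i.1.2 i.2.2 j.1.2 j.2.2 hne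
        obtain ⟨C, A, hC, hA, hCA⟩ := rs_flat_q q hq κ hκ M
        refine ⟨K * C, A, by positivity, hA, fun N z hz => ?_⟩
        have hz0 : 0 < ‖z‖ := norm_pos_iff.2 (hVs _ z hz.1).1
        have h5 := hf z hz
        have h6 := mul_le_mul_of_nonneg_left (hCA N ‖z‖ hz0) hK.le
        simp only [D2, GG, h, if_false]
        rw [mul_assoc] at h5
        refine h5.trans (h6.trans (le_of_eq ?_))
        ring
      · exact triv (fun z hz => absurd ⟨z, hz⟩ hne)
  obtain ⟨g1, b1, hg1d, hg1j, hg1b⟩ := rs_main hm1 heps0 V hVo hVs hVc hcov D1 hD1 hcoc1 hb1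
  obtain ⟨g2, b2, hg2d, hg2j, hg2b⟩ := rs_main hm2 heps0 V hVo hVs hVc hcov D2 hD2 hcoc2 hb2
  have : Nonempty ι := by
    obtain ⟨i, -⟩ := hcov ((eps0 / 2 : ℝ) : ℂ) (by
      norm_cast; positivity) (by
      rw [Complex.norm_real, Real.norm_eq_abs, abs_of_pos (by positivity)]; linarith)
    exact ⟨i⟩
  choose! s hs using hcov
  let H : ι → ℂ → E := fun i z => GG i z - g1 i z - g2 i z
  have hHd : ∀ i, DifferentiableOn ℂ (H i) (V i) := fun i => ((hGd i).sub (hg1d i)).sub (hg2d i)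
  have hHe : ∀ i j, ∀ z ∈ V i ∩ V j, H i z = H j z := by
    intro i j z hz
    have e1 := hg1j i j z hz
    have e2 := hg2j i j z hz
    have e3 : D1 i j z + D2 i j z = GG j z - GG i z := by
      by_cases h : i.1.1 = j.1.1 <;> simp [D1, D2, h]
    rw [← e1, ← e2] at e3
    simp only [H]
    have e4 : GG j z = GG i z + (g1 j z - g1 i z + (g2 j z - g2 i z)) := by rw [e3]; abel
    rw [e4]; abel
  let a0 : ℂ → E := fun z => H (s z) z
  have ha0 : ∀ i, ∀ z ∈ V i, a0 z = H i z := fun i z hz =>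
    hHe _ _ z ⟨hs z (hVs i z hz).1 (hVs i z hz).2, hz⟩
  have ha0d : ∀ z : ℂ, z ≠ 0 → ‖z‖ < eps0 → DifferentiableAt ℂ a0 z := by
    intro z hz hzR
    have hzV := hs z hz hzR
    have : DifferentiableAt ℂ (H (s z)) z := (hHd _).differentiableAt ((hVo _).mem_nhds hzV)
    refine this.congr_of_eventuallyEq ?_
    filter_upwards [(hVo _).mem_nhds hzV] with w hw
    exact ha0 _ w hw
  have hr : eps0 / 2 < eps0 := by linarith
  have hrp : 0 < eps0 / 2 := by positivity
  have hfin : Finite ι := by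
    have : ({x : ℕ × ℕ | x.1 < ς ∧ x.2 < χ x.1}).Finite := by
      refine Set.Finite.subset ((Finset.range ς).sigma (fun p => Finset.range (χ p)) |>.image
        (fun x => (x.1, x.2))).finite_toSet ?_
      rintro ⟨x, y⟩ ⟨h1, h2⟩
      simp only [Finset.coe_image, Set.mem_image, Finset.mem_coe, Finset.mem_sigma, Finset.mem_range]
      exact ⟨⟨x, y⟩, ⟨h1, h2⟩, rfl⟩
    exact this
  have hHb : ∀ i, ∃ B : ℝ, ∀ z ∈ V i, ‖z‖ < eps0 / 2 → ‖H i z‖ ≤ B := by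
    intro i
    obtain ⟨M, hM⟩ := bdd i.1.1 i.2.1 i.1.2 i.2.2
    obtain ⟨C1, A1, -, -, h1⟩ := hg1b i _ hr
    obtain ⟨C2, A2, -, -, h2⟩ := hg2b i _ hr
    refine ⟨M + C1 + C2, fun z hz hzr => ?_⟩
    have h1' := h1 0 z hz hzr
    have h2' := h2 0 z hz hzr
    simp at h1' h2'
    have h3 := norm_sub_le (GG i z - g1 i z) (g2 i z)
    have h4 := norm_sub_le (GG i z) (g1 i z)
    have h5 := hM z hz
    simp only [H, GG] at *
    linarith
  choose B hB using hHb
  obtain ⟨B0, hB0⟩ : ∃ B0, ∀ i, B i ≤ B0 := by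
    obtain ⟨B0, h⟩ := (Set.finite_range B).bddAbove
    exact ⟨B0, fun i => h ⟨i, rfl⟩⟩
  have hball : Metric.ball (0:ℂ) (eps0 / 2) ∈ nhds (0:ℂ) := Metric.ball_mem_nhds _ hrp
  let a : ℂ → E := Function.update a0 0 ((nhdsWithin (0:ℂ) {0}ᶜ).limUnder a0)
  have had : DifferentiableOn ℂ a (Metric.ball (0:ℂ) (eps0 / 2)) := by
    refine Complex.differentiableOn_update_limUnder_of_bddAbove hball ?_ ?_
    · intro z hz
      have h1 : ‖z‖ < eps0 / 2 := by simpa using hz.1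
      exact (ha0d z (by simpa using hz.2) (by linarith)).differentiableWithinAt
    · refine ⟨B0, ?_⟩
      rintro _ ⟨z, hz, rfl⟩
      have h1 : ‖z‖ < eps0 / 2 := by simpa using hz.1
      have h2 := hs z (by simpa using hz.2) (by linarith)
      exact (hB _ z h2 h1).trans (hB0 _)
  refine ⟨fun n => ((n.factorial : ℂ))⁻¹ • iteratedDeriv n a 0, eps0 / 2, a, hrp, ?_, b1, b2, ?_⟩
  · intro z hz
    have := Complex.hasSum_taylorSeries_on_ball had hz
    convert this using 2 with n
    rw [sub_zero, smul_comm]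
  · intro p hp p1 hp1
    let i : ι := ⟨(p, p1), hp, hp1⟩
    refine ⟨g1 i, g2 i, ?_, hg1d i, ?_, hg2d i, ?_⟩
    · intro z hz
      have h1 : a z = a0 z := Function.update_of_ne (hVs i z hz).1 _ _
      rw [h1, ha0 i z hz]
      simp only [H]
      change GG i z = _
      abel
    · intro θ1 θ2 r hsub hcl
      by_cases hne : (planarSector θ1 θ2 r).Nonempty
      · obtain ⟨w, hw⟩ := hne
        obtain ⟨C, A, hC, hA, h⟩ := hg1b i r (rs_subsector (fun z hz => (hVs i z hz).2) hcl hw)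
        exact ⟨C, A, hC, hA, fun N _ z hz => h N z (hsub hz) (rs_sector_norm hz).2⟩
      · exact ⟨1, 1, one_pos, one_pos, fun N _ z hz => absurd ⟨z, hz⟩ hne⟩
    · intro θ1 θ2 r hsub hcl
      by_cases hne : (planarSector θ1 θ2 r).Nonempty
      · obtain ⟨w, hw⟩ := hne
        obtain ⟨C, A, hC, hA, h⟩ := hg2b i r (rs_subsector (fun z hz => (hVs i z hz).2) hcl hw)
        refine ⟨A * q ^ (1 / (2 * κ)), C, by positivity, hC, fun N z hz => ?_⟩
        refine (h (N + 1) z (hsub hz) (rs_sector_norm hz).2).trans (le_of_eq ?_)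
        have e : q ^ (((N + 1 : ℕ) : ℝ) ^ 2 / (2 * κ))
            = (q ^ (1 / (2 * κ))) ^ (N + 1) * q ^ (((N : ℝ) + 1) * N / (2 * κ)) := by
          rw [← Real.rpow_natCast (q ^ _), ← Real.rpow_mul hq0.le, ← Real.rpow_add hq0]
          congr 1
          push_cast; field_simp; ring
        rw [e, mul_pow]; ring
      · exact ⟨1, 1, one_pos, one_pos, fun N z hz => absurd ⟨z, hz⟩ hne⟩
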